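/- arXiv:1909.09379 — 2 statements merged into one kernel-verified Lean document; each statement's English description precedes it below -/
import Mathlib

section
/- Assume (P₂). Let x₀ ∈ ℝ^N be fixed and let ψ ∈ C^∞(ℝ^N) satisfy 0 ≤ ψ ≤ 1, ψ ≡ 1 on B₁(0), supp(ψ) ⊂ B₂(0) and ‖∇ψ‖_∞ ≤ 2; for ρ > 0 set ψ_ρ(x) := ψ((x−x₀)/ρ). Let {u_n} be a bounded sequence in W^{s,p(·,·)}(ℝ^N) converging weakly to some u. Then limsup_{ρ→0⁺} limsup_{n→∞} ∫_{ℝ^N}∫_{ℝ^N} |u_n(x)|^{p(x,y)} · |ψ_ρ(x)−ψ_ρ(y)|^{p(x,y)}/|x−y|^{N+s·p(x,y)} dy dx = 0. -/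
open MeasureTheory Filter Topology Set
open scoped ENNReal NNReal

noncomputable section

/-- Euclidean space `ℝ^N`. -/
abbrev Euc (N : ℕ) := EuclideanSpace ℝ (Fin N)

/-- The modular of the variable exponent Lebesgue space `L^{h(·)}_μ`. -/
def varModular {α : Type*} [MeasurableSpace α] (μ : Measure α) (h : α → ℝ) (u : α → ℝ) : ℝ≥0∞ :=
  ∫⁻ x, ENNReal.ofReal (|u x| ^ (h x)) ∂μ

/-- The Luxemburg norm on the variable exponent Lebesgue space `L^{h(·)}_μ`. -/
def luxNorm {α : Type*} [MeasurableSpace α] (μ : Measure α) (h : α → ℝ) (u : α → ℝ) : ℝ :=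
  sInf {c : ℝ | 0 < c ∧ varModular μ h (fun x => u x / c) ≤ 1}

/-- Membership in the variable exponent Lebesgue space `L^{h(·)}_μ`. -/
def MemVarLp {α : Type*} [MeasurableSpace α] (μ : Measure α) (h : α → ℝ) (u : α → ℝ) : Prop :=
  AEStronglyMeasurable u μ ∧ varModular μ h u < ⊤

/-- The integrand of the Gagliardo-type seminorm with variable exponent. -/
def sobKernel {N : ℕ} (s : ℝ) (p : Euc N → Euc N → ℝ) (u : Euc N → ℝ) (x y : Euc N) : ℝ≥0∞ :=
  ENNReal.ofReal (|u x - u y| ^ (p x y) / dist x y ^ ((N : ℝ) + s * p x y))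

/-- The modular of the fractional Sobolev space `W^{s,p(·,·)}(Ω)`. -/
def sobModular {N : ℕ} (Ω : Set (Euc N)) (s : ℝ) (p : Euc N → Euc N → ℝ)
    (u : Euc N → ℝ) : ℝ≥0∞ :=
  (∫⁻ x in Ω, ENNReal.ofReal (|u x| ^ (p x x))) + ∫⁻ x in Ω, ∫⁻ y in Ω, sobKernel s p u x y

/-- The Luxemburg-type norm of the fractional Sobolev space `W^{s,p(·,·)}(Ω)`. -/
def sobNorm {N : ℕ} (Ω : Set (Euc N)) (s : ℝ) (p : Euc N → Euc N → ℝ) (u : Euc N → ℝ) : ℝ :=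
  sInf {c : ℝ | 0 < c ∧ sobModular Ω s p (fun x => u x / c) ≤ 1}

/-- Membership in the fractional Sobolev space `W^{s,p(·,·)}(Ω)`. -/
def MemSob {N : ℕ} (Ω : Set (Euc N)) (s : ℝ) (p : Euc N → Euc N → ℝ) (u : Euc N → ℝ) : Prop :=
  AEStronglyMeasurable u (volume.restrict Ω) ∧ sobModular Ω s p u < ⊤

/-- A bounded linear functional on `W^{s,p(·,·)}(ℝ^N)`, described by its action on functions. -/
def IsBddLinFunc {N : ℕ} (s : ℝ) (p : Euc N → Euc N → ℝ) (T : (Euc N → ℝ) → ℝ) : Prop :=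
  (∀ f g : Euc N → ℝ, MemSob Set.univ s p f → MemSob Set.univ s p g →
      T (f + g) = T f + T g) ∧
  (∀ (c : ℝ) (f : Euc N → ℝ), MemSob Set.univ s p f → T (c • f) = c * T f) ∧
  ∃ C : ℝ, ∀ f : Euc N → ℝ, MemSob Set.univ s p f → |T f| ≤ C * sobNorm Set.univ s p f

/-- Weak convergence in `W^{s,p(·,·)}(ℝ^N)`. -/
def WeakConvSob {N : ℕ} (s : ℝ) (p : Euc N → Euc N → ℝ)
    (un : ℕ → Euc N → ℝ) (u : Euc N → ℝ) : Prop :=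
  ∀ T : (Euc N → ℝ) → ℝ, IsBddLinFunc s p T →
    Tendsto (fun n => T (un n)) atTop (𝓝 (T u))


lemma euc_finrank {N : ℕ} : Module.finrank ℝ (Euc N) = N := by simp [Euc]

/-- truncated kernel -/
def kk {N : ℕ} (ε a : ℝ) (x y : Euc N) : ℝ≥0∞ :=
  if dist x y < ε then ENNReal.ofReal ((dist x y ^ a)⁻¹) else 0

lemma kk_symm {N : ℕ} (ε a : ℝ) (x y : Euc N) : kk ε a x y = kk ε a y x := by
  unfold kk; rw [dist_comm]

lemma measurable_kk {N : ℕ} (ε a : ℝ) :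
    Measurable (fun z : Euc N × Euc N => kk ε a z.1 z.2) := by
  unfold kk
  refine Measurable.ite ?_ ?_ measurable_const
  · exact measurableSet_lt measurable_dist measurable_const
  · exact ENNReal.measurable_ofReal.comp ((measurable_dist.pow_const a).inv)

lemma le_kk {N : ℕ} {ε a q h : ℝ} (ha : 0 < a) (hq : 0 < q) (hh : h ≤ ε) (v : Euc N → ℝ)
    (x y : Euc N) (hxy : dist x y < h) :
    ‖v x - v y‖ₑ ^ q ≤ ENNReal.ofReal (h ^ a) * (‖v x - v y‖ₑ ^ q * kk ε a x y) := by
  by_cases e : x = y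
  · subst e; simp [hq]
  · have hd : 0 < dist x y := dist_pos.2 e
    have hk : kk ε a x y = ENNReal.ofReal ((dist x y ^ a)⁻¹) := by
      unfold kk; rw [if_pos (lt_of_lt_of_le hxy hh)]
    have h1 : (1 : ℝ≥0∞) ≤ ENNReal.ofReal (h ^ a) * kk ε a x y := by
      rw [hk, ← ENNReal.ofReal_mul (Real.rpow_nonneg (hd.le.trans hxy.le) _)]
      rw [← ENNReal.ofReal_one]
      apply ENNReal.ofReal_le_ofReal
      rw [← div_eq_mul_inv, one_le_div (Real.rpow_pos_of_pos hd _)]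
      exact Real.rpow_le_rpow hd.le hxy.le ha.le
    calc ‖v x - v y‖ₑ ^ q = ‖v x - v y‖ₑ ^ q * 1 := (mul_one _).symm
      _ ≤ ‖v x - v y‖ₑ ^ q * (ENNReal.ofReal (h ^ a) * kk ε a x y) := by gcongr
      _ = _ := by ring

/-- local Gagliardo density -/
def gg {N : ℕ} (ε a q : ℝ) (v : Euc N → ℝ) (x : Euc N) : ℝ≥0∞ :=
  ∫⁻ y, ‖v x - v y‖ₑ ^ q * kk ε a x y

lemma measurable_ggi {N : ℕ} (ε a q : ℝ) {v : Euc N → ℝ} (hv : Measurable v) :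
    Measurable (fun z : Euc N × Euc N => ‖v z.1 - v z.2‖ₑ ^ q * kk ε a z.1 z.2) :=
  ((((hv.comp measurable_fst).sub (hv.comp measurable_snd)).enorm).pow_const q).mul
    (measurable_kk ε a)

lemma measurable_gg {N : ℕ} (ε a q : ℝ) {v : Euc N → ℝ} (hv : Measurable v) :
    Measurable (gg ε a q v) :=
  (measurable_ggi ε a q hv).lintegral_prod_right'

lemma jensen_set {α : Type*} [MeasurableSpace α] (μ : Measure α) {q : ℝ} (hq : 1 < q)
    {f : α → ℝ≥0∞} (hf : AEMeasurable f μ) :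
    (∫⁻ y, f y ∂μ) ^ q ≤ μ univ ^ (q - 1) * ∫⁻ y, f y ^ q ∂μ := by
  have hc := Real.HolderConjugate.conjExponent hq
  have h := ENNReal.lintegral_mul_le_Lp_mul_Lq μ hc hf (g := fun _ => 1) aemeasurable_const
  simp only [Pi.mul_apply, mul_one, ENNReal.one_rpow, lintegral_const, one_mul] at h
  have hq0 : 0 < q := by linarith
  calc (∫⁻ y, f y ∂μ) ^ q ≤ ((∫⁻ y, f y ^ q ∂μ) ^ (1 / q) *
        μ univ ^ (1 / q.conjExponent)) ^ q := ENNReal.rpow_le_rpow h hq0.le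
    _ = _ := by
      rw [ENNReal.mul_rpow_of_nonneg _ _ hq0.le, ← ENNReal.rpow_mul, ← ENNReal.rpow_mul,
        one_div_mul_cancel hq0.ne', ENNReal.rpow_one, mul_comm]
      congr 2
      unfold Real.conjExponent
      have : q - 1 ≠ 0 := by linarith
      field_simp

lemma integrableOn_of_Lq {N : ℕ} {q : ℝ} (hq : 1 < q) {w : Euc N → ℝ}
    (hw : AEStronglyMeasurable w volume) (hwq : ∫⁻ x, ‖w x‖ₑ ^ q ≠ ⊤) (x : Euc N) (h : ℝ) :
    IntegrableOn w (Metric.ball x h) := by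
  refine ⟨hw.restrict, ?_⟩
  have hj := jensen_set (volume.restrict (Metric.ball x h)) hq (f := fun y => ‖w y‖ₑ)
    hw.enorm.restrict
  have h2 : volume.restrict (Metric.ball x h) univ ^ (q - 1) *
      ∫⁻ y in Metric.ball x h, ‖w y‖ₑ ^ q ≠ ⊤ := by
    refine ENNReal.mul_ne_top ?_ (ne_top_of_le_ne_top hwq (setLIntegral_le_lintegral _ _))
    refine ENNReal.rpow_ne_top_of_nonneg (by linarith) ?_
    simp [measure_ball_lt_top.ne]
  have h3 := ne_top_of_le_ne_top h2 hj
  unfold HasFiniteIntegral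
  rw [lt_top_iff_ne_top]
  intro h4
  rw [h4, ENNReal.top_rpow_of_pos (by linarith)] at h3
  exact h3 rfl

lemma avg_pow {N : ℕ} {q : ℝ} (hq : 1 < q) {f : Euc N → ℝ}
    (hf : AEStronglyMeasurable f volume) (x : Euc N) {h : ℝ} (hh : 0 < h) :
    ‖(volume (Metric.ball x h)).toReal⁻¹ * ∫ y in Metric.ball x h, f y‖ₑ ^ q ≤
      (volume (Metric.ball x h))⁻¹ * ∫⁻ y in Metric.ball x h, ‖f y‖ₑ ^ q := by
  set m := volume (Metric.ball x h) with hm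
  have hm0 : m ≠ 0 := (Metric.measure_ball_pos volume x hh).ne'
  have hmt : m ≠ ⊤ := measure_ball_lt_top.ne
  have hq0 : 0 < q := by linarith
  have e1 : ‖m.toReal⁻¹‖ₑ = m⁻¹ := by
    rw [← ENNReal.toReal_inv, Real.enorm_eq_ofReal ENNReal.toReal_nonneg,
      ENNReal.ofReal_toReal (ENNReal.inv_ne_top.2 hm0)]
  have hj := jensen_set (volume.restrict (Metric.ball x h)) hq (f := fun y => ‖f y‖ₑ)
    hf.enorm.restrict
  rw [Measure.restrict_apply_univ, ← hm] at hj
  rw [enorm_mul, e1, ENNReal.mul_rpow_of_nonneg _ _ hq0.le]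
  calc m⁻¹ ^ q * ‖∫ y in Metric.ball x h, f y‖ₑ ^ q
      ≤ m⁻¹ ^ q * (m ^ (q - 1) * ∫⁻ y in Metric.ball x h, ‖f y‖ₑ ^ q) := by
        gcongr
        exact (ENNReal.rpow_le_rpow (enorm_integral_le_lintegral_enorm _) hq0.le).trans hj
    _ = m⁻¹ * ∫⁻ y in Metric.ball x h, ‖f y‖ₑ ^ q := by
        rw [← mul_assoc, ENNReal.inv_rpow, ← ENNReal.rpow_neg, ← ENNReal.rpow_add _ _ hm0 hmt]
        congr 1
        rw [show -q + (q - 1) = -1 by ring, ENNReal.rpow_neg_one]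

lemma avg_bound {N : ℕ} {q : ℝ} (hq : 1 < q) {w : Euc N → ℝ}
    (hw : Measurable w) (hwq : ∫⁻ x, ‖w x‖ₑ ^ q ≠ ⊤) (x : Euc N) {h : ℝ} (hh : 0 < h) :
    ‖w x‖ₑ ^ q ≤ 2 ^ (q - 1) * ((volume (Metric.ball x h))⁻¹ *
        (∫⁻ y in Metric.ball x h, ‖w x - w y‖ₑ ^ q) +
      ‖(volume (Metric.ball x h)).toReal⁻¹ * ∫ y in Metric.ball x h, w y‖ₑ ^ q) := by
  have hi := integrableOn_of_Lq hq hw.aestronglyMeasurable hwq x h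
  have hA := avg_pow hq (f := fun y => w x - w y)
    (measurable_const.sub hw).aestronglyMeasurable x hh
  set m := volume (Metric.ball x h) with hm
  have hm0 : m ≠ 0 := (Metric.measure_ball_pos volume x hh).ne'
  have hmt : m ≠ ⊤ := measure_ball_lt_top.ne
  have hmr : m.toReal ≠ 0 := (ENNReal.toReal_pos hm0 hmt).ne'
  have e : w x = m.toReal⁻¹ * (∫ y in Metric.ball x h, (w x - w y)) +
      m.toReal⁻¹ * ∫ y in Metric.ball x h, w y := by
    rw [integral_sub (by simp [integrable_const_iff, isFiniteMeasure_restrict, hmt, ← hm]) hi]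
    simp only [integral_const, smul_eq_mul, Measure.real, Measure.restrict_apply_univ, ← hm]
    field_simp
    ring
  calc ‖w x‖ₑ ^ q ≤ (‖m.toReal⁻¹ * (∫ y in Metric.ball x h, (w x - w y))‖ₑ +
      ‖m.toReal⁻¹ * ∫ y in Metric.ball x h, w y‖ₑ) ^ q := by
        refine ENNReal.rpow_le_rpow ?_ (by linarith)
        conv_lhs => rw [e]
        exact enorm_add_le _ _
    _ ≤ _ := ENNReal.rpow_add_le_mul_rpow_add_rpow _ _ hq.le
    _ ≤ _ := by gcongr

lemma vol_ball {N : ℕ} (x : Euc N) {h : ℝ} (hh : 0 < h) :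
    volume (Metric.ball x h) = ENNReal.ofReal (h ^ (N : ℝ)) * volume (Metric.ball (0 : Euc N) 1) := by
  rw [Measure.addHaar_ball_of_pos volume x hh, euc_finrank, Real.rpow_natCast]

lemma ratio_ball {N : ℕ} {a : ℝ} (x : Euc N) {h : ℝ} (hh : 0 < h) :
    (volume (Metric.ball x h))⁻¹ * ENNReal.ofReal (h ^ a) =
      ENNReal.ofReal (h ^ (a - N)) * (volume (Metric.ball (0 : Euc N) 1))⁻¹ := by
  have hp : 0 < h ^ (N : ℝ) := Real.rpow_pos_of_pos hh _
  rw [vol_ball x hh, ENNReal.mul_inv (Or.inl (by simpa using hp)) (Or.inl ENNReal.ofReal_ne_top),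
    Real.rpow_sub hh, div_eq_inv_mul, ENNReal.ofReal_mul (by positivity),
    ENNReal.ofReal_inv_of_pos hp]
  ring

lemma tendsto_ofReal_rpow {b : ℝ} (hb : 0 < b) :
    Tendsto (fun h : ℝ => ENNReal.ofReal (h ^ b)) (𝓝[>] 0) (𝓝 0) := by
  have h1 : Tendsto (fun h : ℝ => h ^ b) (𝓝[>] 0) (𝓝 0) := by
    have := (Real.continuousAt_rpow_const 0 b (Or.inr hb.le)).tendsto
    rw [Real.zero_rpow hb.ne'] at this
    exact this.mono_left nhdsWithin_le_nhds
  simpa using (ENNReal.tendsto_ofReal h1)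

lemma measurable_ballint {N : ℕ} {w : Euc N → ℝ} (hw : Measurable w) (h : ℝ) :
    Measurable (fun x => ∫ y in Metric.ball x h, w y) := by
  have e : (fun x => ∫ y in Metric.ball x h, w y) =
      fun x => ∫ y, {z : Euc N × Euc N | dist z.2 z.1 < h}.indicator (fun z => w z.2) (x, y) := by
    funext x
    rw [← integral_indicator Metric.isOpen_ball.measurableSet]
    rfl
  rw [e]
  apply StronglyMeasurable.measurable
  apply StronglyMeasurable.integral_prod_right'
    (f := {z : Euc N × Euc N | dist z.2 z.1 < h}.indicator (fun z => w z.2))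
  exact ((hw.comp measurable_snd).indicator
    (measurableSet_lt (measurable_snd.dist measurable_fst) measurable_const)).stronglyMeasurable

lemma conv_weight_aux {N : ℕ} {q a ε : ℝ} (hq : 1 < q) (ha : 0 < a)
    {w : Euc N → ℝ} (hw : Measurable w) {M : ℝ≥0∞} (hMt : M ≠ ⊤)
    (hM1 : ∫⁻ x, ‖w x‖ₑ ^ q ≤ M) (hM2 : ∫⁻ x, gg ε a q w x ≤ M)
    {Φ : Euc N → ℝ≥0∞} (hΦ : Measurable Φ) {C : ℝ≥0∞} (hΦC : ∀ x, Φ x ≤ C)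
    {h : ℝ} (hh : 0 < h) (hhε : h ≤ ε) :
    ∫⁻ x, ‖w x‖ₑ ^ q * Φ x ≤ 2 ^ (q - 1) * (C * M *
      (ENNReal.ofReal (h ^ (a - N)) * (volume (Metric.ball (0 : Euc N) 1))⁻¹)
      + ∫⁻ x, ‖(volume (Metric.ball (0 : Euc N) h)).toReal⁻¹ *
        ∫ y in Metric.ball x h, w y‖ₑ ^ q * Φ x) := by
  have hwt : ∫⁻ x, ‖w x‖ₑ ^ q ≠ ⊤ := ne_top_of_le_ne_top hMt hM1
  set m := volume (Metric.ball (0 : Euc N) h) with hm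
  have hmx : ∀ x : Euc N, volume (Metric.ball x h) = m := fun x =>
    Measure.addHaar_ball_center volume x h
  rw [← ratio_ball (0 : Euc N) hh, ← hm]
  have hS : Measurable fun x => ‖m.toReal⁻¹ * ∫ y in Metric.ball x h, w y‖ₑ ^ q * Φ x :=
    (((measurable_ballint hw h).const_mul _).enorm.pow_const q).mul hΦ
  have key : ∀ x, ‖w x‖ₑ ^ q * Φ x ≤ 2 ^ (q - 1) * (C * (m⁻¹ * ENNReal.ofReal (h ^ a)) *
      gg ε a q w x + ‖m.toReal⁻¹ * ∫ y in Metric.ball x h, w y‖ₑ ^ q * Φ x) := by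
    intro x
    have h1 := avg_bound hq hw hwt x hh
    rw [hmx x] at h1
    have h2 : ∫⁻ y in Metric.ball x h, ‖w x - w y‖ₑ ^ q ≤ ENNReal.ofReal (h ^ a) * gg ε a q w x := by
      unfold gg
      rw [← lintegral_const_mul' _ _ ENNReal.ofReal_ne_top]
      refine (setLIntegral_mono' Metric.isOpen_ball.measurableSet ?_).trans
        (setLIntegral_le_lintegral (Metric.ball x h) _)
      intro y hy
      exact le_kk ha (by linarith) hhε w x y (by rw [dist_comm]; exact hy)
    calc ‖w x‖ₑ ^ q * Φ x ≤ (2 ^ (q - 1) * (m⁻¹ * (ENNReal.ofReal (h ^ a) * gg ε a q w x) +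
          ‖m.toReal⁻¹ * ∫ y in Metric.ball x h, w y‖ₑ ^ q)) * Φ x := by
            gcongr
            refine h1.trans ?_
            gcongr
      _ = 2 ^ (q - 1) * (Φ x * (m⁻¹ * ENNReal.ofReal (h ^ a)) * gg ε a q w x +
          ‖m.toReal⁻¹ * ∫ y in Metric.ball x h, w y‖ₑ ^ q * Φ x) := by ring
      _ ≤ _ := by gcongr; exact hΦC x
  calc _ ≤ ∫⁻ x, 2 ^ (q - 1) * (C * (m⁻¹ * ENNReal.ofReal (h ^ a)) *
      gg ε a q w x + ‖m.toReal⁻¹ * ∫ y in Metric.ball x h, w y‖ₑ ^ q * Φ x) := lintegral_mono key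
    _ = 2 ^ (q - 1) * (C * (m⁻¹ * ENNReal.ofReal (h ^ a)) * (∫⁻ x, gg ε a q w x) +
        ∫⁻ x, ‖m.toReal⁻¹ * ∫ y in Metric.ball x h, w y‖ₑ ^ q * Φ x) := by
      rw [lintegral_const_mul' _ _ (ENNReal.rpow_ne_top_of_nonneg (by linarith) (by simp)),
        lintegral_add_right _ hS, lintegral_const_mul _ (measurable_gg ε a q hw)]
    _ ≤ 2 ^ (q - 1) * (C * (m⁻¹ * ENNReal.ofReal (h ^ a)) * M +
        ∫⁻ x, ‖m.toReal⁻¹ * ∫ y in Metric.ball x h, w y‖ₑ ^ q * Φ x) := by gcongr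
    _ = _ := by ring

lemma conv_weight {N : ℕ} {q a ε : ℝ} (hq : 1 < q) (ha : (N : ℝ) < a) (hε : 0 < ε)
    {w : ℕ → Euc N → ℝ} (hw : ∀ n, Measurable (w n)) {M : ℝ≥0∞} (hMt : M ≠ ⊤)
    (hM1 : ∀ n, ∫⁻ x, ‖w n x‖ₑ ^ q ≤ M) (hM2 : ∀ n, ∫⁻ x, gg ε a q (w n) x ≤ M)
    (hconv : ∀ (x : Euc N) (h : ℝ), 0 < h →
      Tendsto (fun n => ∫ y in Metric.ball x h, w n y) atTop (𝓝 0))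
    {Φ : Euc N → ℝ≥0∞} (hΦ : Measurable Φ) {C : ℝ≥0∞} (hC : C ≠ ⊤) (hΦC : ∀ x, Φ x ≤ C)
    (hΦi : ∫⁻ x, Φ x ≠ ⊤) :
    Tendsto (fun n => ∫⁻ x, ‖w n x‖ₑ ^ q * Φ x) atTop (𝓝 0) := by
  have hq0 : 0 < q := by linarith
  have ha0 : 0 < a := lt_of_le_of_lt (Nat.cast_nonneg N) ha
  have h2t : (2 : ℝ≥0∞) ^ (q - 1) ≠ ⊤ := ENNReal.rpow_ne_top_of_nonneg (by linarith) (by simp)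
  have hm1 : (volume (Metric.ball (0 : Euc N) 1))⁻¹ ≠ ⊤ :=
    ENNReal.inv_ne_top.2 (Metric.measure_ball_pos volume _ one_pos).ne'
  rw [ENNReal.tendsto_nhds_zero]
  intro e he
  have hT : Tendsto (fun h : ℝ => 2 ^ (q - 1) * (C * M *
      (ENNReal.ofReal (h ^ (a - N)) * (volume (Metric.ball (0 : Euc N) 1))⁻¹))) (𝓝[>] 0) (𝓝 0) := by
    have h1 := tendsto_ofReal_rpow (b := a - N) (by linarith)
    have h2 := ENNReal.Tendsto.mul_const h1 (b := (volume (Metric.ball (0 : Euc N) 1))⁻¹) (Or.inr hm1)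
    have h3 := ENNReal.Tendsto.const_mul h2 (a := C * M) (Or.inr (ENNReal.mul_ne_top hC hMt))
    have h4 := ENNReal.Tendsto.const_mul h3 (a := 2 ^ (q - 1)) (Or.inr h2t)
    simpa using h4
  have he2 : 0 < e / 2 := ENNReal.half_pos he.ne'
  have hε' : ∀ᶠ h : ℝ in 𝓝[>] 0, h ≤ ε := by
    filter_upwards [Ioo_mem_nhdsGT hε] with h hh using hh.2.le
  obtain ⟨h, h1, h2, h3⟩ := ((ENNReal.tendsto_nhds_zero.1 hT (e / 2) he2).and
    (hε'.and self_mem_nhdsWithin)).exists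
  have hh : 0 < h := h3
  set m := volume (Metric.ball (0 : Euc N) h) with hm
  have hmx : ∀ x : Euc N, volume (Metric.ball x h) = m := fun x =>
    Measure.addHaar_ball_center volume x h
  have hm0 : m ≠ 0 := (Metric.measure_ball_pos volume _ hh).ne'
  have hS : ∀ n, Measurable fun x => ‖m.toReal⁻¹ * ∫ y in Metric.ball x h, w n y‖ₑ ^ q * Φ x :=
    fun n => (((measurable_ballint (hw n) h).const_mul _).enorm.pow_const q).mul hΦ
  have hD : Tendsto (fun n => ∫⁻ x, ‖m.toReal⁻¹ * ∫ y in Metric.ball x h, w n y‖ₑ ^ q * Φ x)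
      atTop (𝓝 (∫⁻ x : Euc N, 0)) := by
    refine tendsto_lintegral_of_dominated_convergence (fun x => m⁻¹ * M * Φ x) hS ?_ ?_ ?_
    · intro n
      refine Eventually.of_forall fun x => ?_
      have := avg_pow hq (hw n).aestronglyMeasurable x hh
      rw [hmx x] at this
      simp only
      gcongr
      refine this.trans ?_
      gcongr
      exact (setLIntegral_le_lintegral _ _).trans (hM1 n)
    · rw [lintegral_const_mul _ hΦ]
      exact ENNReal.mul_ne_top (ENNReal.mul_ne_top (ENNReal.inv_ne_top.2 hm0) hMt) hΦi
    · refine Eventually.of_forall fun x => ?_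
      have t1 := (hconv x h hh).const_mul m.toReal⁻¹
      have t2 := ((ENNReal.continuous_rpow_const (y := q)).tendsto _).comp t1.enorm
      simp only [mul_zero, enorm_zero, ENNReal.zero_rpow_of_pos hq0] at t2
      have t3 := ENNReal.Tendsto.mul_const t2 (b := Φ x)
        (Or.inr (ne_top_of_le_ne_top hC (hΦC x)))
      simpa using t3
  have hD' := ENNReal.Tendsto.const_mul hD (a := 2 ^ (q - 1)) (Or.inr h2t)
  simp only [lintegral_const, zero_mul, mul_zero] at hD'
  filter_upwards [ENNReal.tendsto_nhds_zero.1 hD' (e / 2) he2] with n hn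
  refine (conv_weight_aux hq ha0 (hw n) hMt (hM1 n) (hM2 n) hΦ hΦC hh h2).trans ?_
  rw [mul_add]
  exact (add_le_add h1 hn).trans_eq (ENNReal.add_halves e)

lemma iter_zero {f g : ℝ → ℝ≥0∞} {lam R : ℝ} (hl : 1 < lam) (hR : 0 < R)
    (hfin : ∀ δ : ℝ, 0 < δ → ∃ B : ℝ≥0∞, B ≠ ⊤ ∧ ∀ r, δ ≤ r → f r ≤ B)
    (hg : Tendsto g (𝓝[>] 0) (𝓝 0))
    (hrec : ∀ r, 0 < r → r < R → f r ≤ g r + 2⁻¹ * f (lam * r)) :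
    Tendsto f (𝓝[>] 0) (𝓝 0) := by
  rw [ENNReal.tendsto_nhds_zero]
  intro e he
  set t : ℝ≥0∞ := min e 1 / 4 with ht
  have ht0 : 0 < t := ENNReal.div_pos (by simp [he.ne']) (by simp)
  have htt : t ≠ ⊤ := ENNReal.div_ne_top (by simp) (by simp)
  have h4t : 2 * t + 2 * t ≤ e := by
    have : 2 * t + 2 * t = min e 1 := by
      rw [ht, ← two_mul, ← mul_assoc]
      rw [show (2 : ℝ≥0∞) * 2 = 4 by norm_num]
      exact ENNReal.mul_div_cancel (by simp) (by simp)
    rw [this]; exact min_le_left _ _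
  have hlam0 : 0 < lam := by linarith
  obtain ⟨δ0, hδ0, hgδ⟩ := mem_nhdsGT_iff_exists_Ioo_subset.1 (ENNReal.tendsto_nhds_zero.1 hg t ht0)
  set δ := min δ0 R with hδd
  have hδ : 0 < δ := lt_min hδ0 hR
  have hrec' : ∀ r, 0 < r → r < δ → f r ≤ t + 2⁻¹ * f (lam * r) := by
    intro r h0 h1
    refine (hrec r h0 (h1.trans_le (min_le_right _ _))).trans ?_
    gcongr
    exact hgδ ⟨h0, h1.trans_le (min_le_left _ _)⟩
  obtain ⟨B, hB, hfB⟩ := hfin δ hδ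
  have hhalf : ∀ c : ℝ≥0∞, t + 2⁻¹ * (2 * t + c) = 2 * t + 2⁻¹ * c := by
    intro c
    rw [mul_add, ← mul_assoc, ENNReal.inv_mul_cancel (by simp) (by simp), one_mul, ← add_assoc,
      two_mul]
  have c1 : ∀ n : ℕ, ∀ r, 0 < r → δ ≤ lam ^ n * r → f r ≤ 2 * t + B := by
    intro n
    induction n with
    | zero =>
      intro r hr h
      exact (hfB r (by simpa using h)).trans le_add_self
    | succ n ih =>
      intro r hr h
      by_cases hrδ : δ ≤ r
      · exact (hfB r hrδ).trans le_add_self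
      · refine (hrec' r hr (not_le.1 hrδ)).trans ?_
        have := ih (lam * r) (by positivity) (by rw [← mul_assoc, ← pow_succ]; exact h)
        calc t + 2⁻¹ * f (lam * r) ≤ t + 2⁻¹ * (2 * t + B) := by gcongr
          _ = 2 * t + 2⁻¹ * B := hhalf B
          _ ≤ 2 * t + B := by
            gcongr
            calc 2⁻¹ * B ≤ 1 * B := by gcongr; simp
              _ = B := one_mul B
  set K := 2 * t + B with hK
  have hKt : K ≠ ⊤ := by
    rw [hK]; exact ENNReal.add_ne_top.2 ⟨ENNReal.mul_ne_top (by simp) htt, hB⟩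
  have c2 : ∀ n : ℕ, ∀ r, 0 < r → lam ^ n * r < δ → f r ≤ 2 * t + 2⁻¹ ^ n * K := by
    intro n
    induction n with
    | zero =>
      intro r hr h
      obtain ⟨k, hk⟩ := pow_unbounded_of_one_lt (δ / r) hl
      refine (c1 k r hr ((div_lt_iff₀ hr).1 hk).le).trans ?_
      simp
    | succ n ih =>
      intro r hr h
      have hrδ : r < δ := by
        refine lt_of_le_of_lt ?_ h
        have : 1 ≤ lam ^ (n + 1) := one_le_pow₀ hl.le
        nlinarith
      refine (hrec' r hr hrδ).trans ?_
      have := ih (lam * r) (by positivity) (by rw [← mul_assoc, ← pow_succ]; exact h)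
      calc t + 2⁻¹ * f (lam * r) ≤ t + 2⁻¹ * (2 * t + 2⁻¹ ^ n * K) := by gcongr
        _ = 2 * t + 2⁻¹ * (2⁻¹ ^ n * K) := hhalf _
        _ = _ := by rw [pow_succ]; ring
  have hpow : Tendsto (fun n : ℕ => (2⁻¹ : ℝ≥0∞) ^ n * K) atTop (𝓝 0) := by
    have h1 := ENNReal.tendsto_pow_atTop_nhds_zero_of_lt_one (r := 2⁻¹) (by simp)
    simpa using ENNReal.Tendsto.mul_const h1 (b := K) (Or.inr hKt)
  obtain ⟨n, hn⟩ := (ENNReal.tendsto_nhds_zero.1 hpow (2 * t) (ENNReal.mul_pos (by simp) ht0.ne')).exists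
  have hp : 0 < lam ^ n := by positivity
  filter_upwards [Ioo_mem_nhdsGT (show 0 < δ / lam ^ n by positivity)] with r hr
  refine (c2 n r hr.1 ?_).trans ((add_le_add_right hn _).trans h4t)
  have := (lt_div_iff₀ hp).1 hr.2
  linarith

lemma ball_rec {N : ℕ} {q a ε : ℝ} (hq : 1 < q) (ha : 0 < a)
    {v : Euc N → ℝ} (hv : Measurable v) (x₀ : Euc N) {r lam : ℝ} (hl : 1 < lam) (hr : 0 < r)
    (hrε : 2 * (lam * r) ≤ ε) :
    volume (Metric.ball x₀ (lam * r)) * ∫⁻ x in Metric.ball x₀ r, ‖v x‖ₑ ^ q ≤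
      2 ^ (q - 1) * (ENNReal.ofReal ((2 * (lam * r)) ^ a) * (∫⁻ x in Metric.ball x₀ r, gg ε a q v x)
        + (∫⁻ x in Metric.ball x₀ (lam * r), ‖v x‖ₑ ^ q) * volume (Metric.ball x₀ r)) := by
  have h2t : (2 : ℝ≥0∞) ^ (q - 1) ≠ ⊤ := ENNReal.rpow_ne_top_of_nonneg (by linarith) (by simp)
  have hvm : Measurable fun x => ‖v x‖ₑ ^ q := hv.enorm.pow_const q
  have key : ∀ x ∈ Metric.ball x₀ r, volume (Metric.ball x₀ (lam * r)) * ‖v x‖ₑ ^ q ≤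
      2 ^ (q - 1) * (ENNReal.ofReal ((2 * (lam * r)) ^ a) * gg ε a q v x +
        ∫⁻ y in Metric.ball x₀ (lam * r), ‖v y‖ₑ ^ q) := by
    intro x hx
    have hx' : dist x x₀ < lam * r := lt_of_lt_of_le hx (by nlinarith)
    calc volume (Metric.ball x₀ (lam * r)) * ‖v x‖ₑ ^ q
        = ∫⁻ y in Metric.ball x₀ (lam * r), ‖v x‖ₑ ^ q := by
          rw [setLIntegral_const, mul_comm]
      _ ≤ ∫⁻ y in Metric.ball x₀ (lam * r), 2 ^ (q - 1) * (ENNReal.ofReal ((2 * (lam * r)) ^ a) *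
          (‖v x - v y‖ₑ ^ q * kk ε a x y) + ‖v y‖ₑ ^ q) := by
          refine setLIntegral_mono' Metric.isOpen_ball.measurableSet fun y hy => ?_
          have hxy : dist x y < 2 * (lam * r) := by
            have h1 := dist_triangle x x₀ y
            have h2 : dist x₀ y < lam * r := by rw [dist_comm]; exact hy
            linarith
          calc ‖v x‖ₑ ^ q ≤ (‖v x - v y‖ₑ + ‖v y‖ₑ) ^ q := by
                refine ENNReal.rpow_le_rpow ?_ (by linarith)
                conv_lhs => rw [show v x = (v x - v y) + v y by ring]
                exact enorm_add_le _ _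
            _ ≤ 2 ^ (q - 1) * (‖v x - v y‖ₑ ^ q + ‖v y‖ₑ ^ q) :=
                ENNReal.rpow_add_le_mul_rpow_add_rpow _ _ hq.le
            _ ≤ _ := by
                gcongr
                exact le_kk ha (by linarith) hrε v x y hxy
      _ = 2 ^ (q - 1) * (ENNReal.ofReal ((2 * (lam * r)) ^ a) *
          (∫⁻ y in Metric.ball x₀ (lam * r), ‖v x - v y‖ₑ ^ q * kk ε a x y) +
            ∫⁻ y in Metric.ball x₀ (lam * r), ‖v y‖ₑ ^ q) := by
          rw [lintegral_const_mul' _ _ h2t, lintegral_add_right _ hvm,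
            lintegral_const_mul' _ _ ENNReal.ofReal_ne_top]
      _ ≤ _ := by
          gcongr
          exact setLIntegral_le_lintegral _ _
  calc _ = ∫⁻ x in Metric.ball x₀ r, volume (Metric.ball x₀ (lam * r)) * ‖v x‖ₑ ^ q := by
        rw [lintegral_const_mul _ hvm]
    _ ≤ ∫⁻ x in Metric.ball x₀ r, 2 ^ (q - 1) * (ENNReal.ofReal ((2 * (lam * r)) ^ a) * gg ε a q v x +
        ∫⁻ y in Metric.ball x₀ (lam * r), ‖v y‖ₑ ^ q) :=
        setLIntegral_mono' Metric.isOpen_ball.measurableSet key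
    _ = _ := by
        rw [lintegral_const_mul' _ _ h2t, lintegral_add_right _ measurable_const,
            lintegral_const_mul' _ _ ENNReal.ofReal_ne_top, setLIntegral_const]

lemma vol_ball_tendsto {N : ℕ} (hN : 0 < N) (x₀ : Euc N) {c : ℝ} (hc : 0 < c) :
    Tendsto (fun r : ℝ => volume (Metric.ball x₀ (c * r))) (𝓝[>] 0) (𝓝 0) := by
  have hm1 : volume (Metric.ball (0 : Euc N) 1) ≠ ⊤ := measure_ball_lt_top.ne
  have h1 := tendsto_ofReal_rpow (b := (N : ℝ)) (by exact_mod_cast hN)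
  have h2 := ENNReal.Tendsto.const_mul (ENNReal.Tendsto.mul_const h1
    (b := volume (Metric.ball (0 : Euc N) 1)) (Or.inr hm1)) (a := ENNReal.ofReal (c ^ (N : ℝ)))
    (Or.inr ENNReal.ofReal_ne_top)
  rw [zero_mul, mul_zero] at h2
  refine h2.congr' ?_
  filter_upwards [self_mem_nhdsWithin] with r hr
  have hr' : 0 < r := hr
  rw [vol_ball x₀ (by positivity : 0 < c * r), Real.mul_rpow hc.le hr'.le,
    ENNReal.ofReal_mul (by positivity)]
  ring

lemma small_ball {N : ℕ} (hN : 0 < N) {q b ε : ℝ} (hq : 1 < q) (hb : 0 < b) (hbN : b < N)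
    (hε : 0 < ε) {v : Euc N → ℝ} (hv : Measurable v) (hvq : ∫⁻ x, ‖v x‖ₑ ^ q ≠ ⊤)
    (hvg : ∫⁻ x, gg ε (N + b) q v x ≠ ⊤) (x₀ : Euc N) :
    Tendsto (fun r : ℝ => ENNReal.ofReal (r ^ (-b)) * ∫⁻ x in Metric.ball x₀ r, ‖v x‖ₑ ^ q)
      (𝓝[>] 0) (𝓝 0) := by
  have h2t : (2 : ℝ≥0∞) ^ (q - 1) ≠ ⊤ := ENNReal.rpow_ne_top_of_nonneg (by linarith) (by simp)
  have hm1 : (volume (Metric.ball (0 : Euc N) 1))⁻¹ ≠ ⊤ :=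
    ENNReal.inv_ne_top.2 (Metric.measure_ball_pos volume _ one_pos).ne'
  obtain ⟨lam, hl, hlam⟩ : ∃ lam : ℝ, 1 < lam ∧
      2 ^ (q - 1) * ENNReal.ofReal (lam ^ (b - N)) ≤ 2⁻¹ := by
    have h1 : Tendsto (fun l : ℝ => ENNReal.ofReal (l ^ (b - N))) atTop (𝓝 0) := by
      have := ENNReal.tendsto_ofReal (tendsto_rpow_neg_atTop (y := N - b) (by linarith))
      simpa using this
    have h2 := ENNReal.Tendsto.const_mul h1 (a := 2 ^ (q - 1)) (Or.inr h2t)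
    rw [mul_zero] at h2
    obtain ⟨l, h3, h4⟩ := ((ENNReal.tendsto_nhds_zero.1 h2 2⁻¹ (by simp)).and
      (eventually_gt_atTop 1)).exists
    exact ⟨l, h4, h3⟩
  have hl0 : 0 < lam := by linarith
  set D : ℝ≥0∞ := 2 ^ (q - 1) * (ENNReal.ofReal (2 ^ (N + b) * lam ^ b) *
    (volume (Metric.ball (0 : Euc N) 1))⁻¹) with hD
  have hDt : D ≠ ⊤ := ENNReal.mul_ne_top h2t (ENNReal.mul_ne_top ENNReal.ofReal_ne_top hm1)
  refine iter_zero (g := fun r => D * ∫⁻ x in Metric.ball x₀ r, gg ε (N + b) q v x)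
    (R := ε / (2 * lam)) hl (by positivity) ?_ ?_ ?_
  · intro δ hδ
    refine ⟨ENNReal.ofReal (δ ^ (-b)) * ∫⁻ x, ‖v x‖ₑ ^ q,
      ENNReal.mul_ne_top ENNReal.ofReal_ne_top hvq, fun r hr => ?_⟩
    refine mul_le_mul' (ENNReal.ofReal_le_ofReal ?_) (setLIntegral_le_lintegral _ _)
    exact Real.rpow_le_rpow_of_nonpos hδ hr (by linarith)
  · have h1 := vol_ball_tendsto hN x₀ one_pos
    simp only [one_mul] at h1
    have := ENNReal.Tendsto.const_mul (tendsto_setLIntegral_zero hvg h1) (a := D) (Or.inr hDt)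
    simpa using this
  · intro r hr hrR
    have hrε : 2 * (lam * r) ≤ ε := by
      rw [lt_div_iff₀ (by positivity)] at hrR
      linarith
    have h := ball_rec hq (by positivity : (0 : ℝ) < N + b) hv x₀ hl hr hrε
    have hlr : 0 < lam * r := by positivity
    set V := volume (Metric.ball x₀ (lam * r)) with hV
    have hV0 : V ≠ 0 := (Metric.measure_ball_pos volume _ hlr).ne'
    have hVt : V ≠ ⊤ := measure_ball_lt_top.ne
    set A := ∫⁻ x in Metric.ball x₀ r, ‖v x‖ₑ ^ q
    set G := ∫⁻ x in Metric.ball x₀ r, gg ε (N + b) q v x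
    set A' := ∫⁻ x in Metric.ball x₀ (lam * r), ‖v x‖ₑ ^ q
    have e1 : V⁻¹ * ENNReal.ofReal ((2 * (lam * r)) ^ ((N : ℝ) + b)) =
        ENNReal.ofReal (2 ^ (N + b) * lam ^ b) * ENNReal.ofReal (r ^ b) *
          (volume (Metric.ball (0 : Euc N) 1))⁻¹ := by
      rw [Real.mul_rpow (by norm_num) hlr.le, ENNReal.ofReal_mul (by positivity), mul_left_comm,
        ratio_ball x₀ hlr, show (N : ℝ) + b - N = b by ring, Real.mul_rpow hl0.le hr.le,
        ENNReal.ofReal_mul (by positivity), ENNReal.ofReal_mul (by positivity)]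
      ring
    have e2 : V⁻¹ * volume (Metric.ball x₀ r) = ENNReal.ofReal (lam ^ (-(N : ℝ))) := by
      rw [hV, vol_ball x₀ hlr, vol_ball x₀ hr, Real.mul_rpow hl0.le hr.le,
        ENNReal.ofReal_mul (by positivity), Real.rpow_neg hl0.le,
        ENNReal.ofReal_inv_of_pos (by positivity), mul_assoc,
        ENNReal.mul_inv (Or.inl (ENNReal.ofReal_pos.2 (Real.rpow_pos_of_pos hl0 _)).ne')
          (Or.inl ENNReal.ofReal_ne_top), mul_assoc, ENNReal.inv_mul_cancel, mul_one]
      · refine mul_ne_zero (ENNReal.ofReal_pos.2 (Real.rpow_pos_of_pos hr _)).ne'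
          (Metric.measure_ball_pos volume _ one_pos).ne'
      · exact ENNReal.mul_ne_top ENNReal.ofReal_ne_top measure_ball_lt_top.ne
    have e3 : ENNReal.ofReal (r ^ (-b)) * ENNReal.ofReal (r ^ b) = 1 := by
      rw [← ENNReal.ofReal_mul (by positivity), ← Real.rpow_add hr]; simp
    have e4 : ENNReal.ofReal (r ^ (-b)) * ENNReal.ofReal (lam ^ (-(N : ℝ))) =
        ENNReal.ofReal (lam ^ (b - N)) * ENNReal.ofReal ((lam * r) ^ (-b)) := by
      rw [← ENNReal.ofReal_mul (by positivity), ← ENNReal.ofReal_mul (by positivity)]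
      congr 1
      rw [Real.mul_rpow hl0.le hr.le, ← mul_assoc, ← Real.rpow_add hl0]
      rw [show b - N + -b = -(N : ℝ) by ring]; ring
    have hA : A = V⁻¹ * (V * A) := by
      rw [← mul_assoc, ENNReal.inv_mul_cancel hV0 hVt, one_mul]
    calc ENNReal.ofReal (r ^ (-b)) * A = ENNReal.ofReal (r ^ (-b)) * (V⁻¹ * (V * A)) := by rw [← hA]
      _ ≤ ENNReal.ofReal (r ^ (-b)) * (V⁻¹ * (2 ^ (q - 1) * (ENNReal.ofReal ((2 * (lam * r)) ^ ((N : ℝ) + b))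
          * G + A' * volume (Metric.ball x₀ r)))) := by gcongr
      _ = 2 ^ (q - 1) * (ENNReal.ofReal (r ^ (-b)) *
          (V⁻¹ * ENNReal.ofReal ((2 * (lam * r)) ^ ((N : ℝ) + b))) * G +
          ENNReal.ofReal (r ^ (-b)) * (V⁻¹ * volume (Metric.ball x₀ r)) * A') := by ring
      _ = 2 ^ (q - 1) * (ENNReal.ofReal (r ^ (-b)) * ENNReal.ofReal (r ^ b) *
          (ENNReal.ofReal (2 ^ (N + b) * lam ^ b) * (volume (Metric.ball (0 : Euc N) 1))⁻¹) * G +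
          ENNReal.ofReal (lam ^ (b - N)) * ENNReal.ofReal ((lam * r) ^ (-b)) * A') := by
          rw [e1, e2, e4]; ring
      _ = D * G + (2 ^ (q - 1) * ENNReal.ofReal (lam ^ (b - N))) *
          (ENNReal.ofReal ((lam * r) ^ (-b)) * A') := by
          rw [e3, hD]; ring
      _ ≤ _ := by gcongr

lemma kern_fin {N : ℕ} (hN : 0 < N) {q b : ℝ} (hb : 0 < b) (hbq : b < q) :
    ∫⁻ z : Euc N, ENNReal.ofReal ((min 1 (2 * ‖z‖)) ^ q * (‖z‖ ^ ((N : ℝ) + b))⁻¹) ≠ ⊤ := by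
  have : Nonempty (Fin N) := ⟨⟨0, hN⟩⟩
  have : Nontrivial (Euc N) := inferInstance
  have hq : 0 < q := by linarith
  have hmeas : Measurable fun t : ℝ => (min 1 (2 * t)) ^ q * (t ^ ((N : ℝ) + b))⁻¹ :=
    (((measurable_const.min (measurable_id.const_mul 2)).pow_const q)).mul
      ((measurable_id.pow_const _).inv)
  have hI : Integrable (fun z : Euc N => (fun t : ℝ => (min 1 (2 * t)) ^ q *
      (t ^ ((N : ℝ) + b))⁻¹) ‖z‖) volume := by
    refine (integrable_fun_norm_addHaar (volume : Measure (Euc N)) (f := fun t : ℝ =>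
      (min 1 (2 * t)) ^ q * (t ^ ((N : ℝ) + b))⁻¹)).2 ?_
    rw [euc_finrank]
    rw [← Ioc_union_Ioi_eq_Ioi (zero_le_one' ℝ)]
    have hm2 : Measurable fun y : ℝ => y ^ (N - 1) • ((min 1 (2 * y)) ^ q *
      (y ^ ((N : ℝ) + b))⁻¹) := (measurable_id.pow_const (N - 1)).smul hmeas
    have hpow : ∀ y : ℝ, 0 < y → y ^ (N - 1) * (y ^ ((N : ℝ) + b))⁻¹ = y ^ (-1 - b) := by
      intro y hy
      rw [← Real.rpow_natCast, ← Real.rpow_neg hy.le, ← Real.rpow_add hy]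
      congr 1
      rw [Nat.cast_sub hN]; push_cast; ring
    refine IntegrableOn.union ?_ ?_
    · have h1 : IntegrableOn (fun y : ℝ => 2 ^ q * y ^ (q - 1 - b)) (Ioc 0 1) := by
        have := (intervalIntegral.intervalIntegrable_rpow' (a := 0) (b := 1)
          (show -1 < q - 1 - b by linarith)).const_mul (2 ^ q)
        rwa [intervalIntegrable_iff_integrableOn_Ioc_of_le zero_le_one] at this
      refine Integrable.mono' h1 hm2.aestronglyMeasurable ?_
      refine (ae_restrict_iff' measurableSet_Ioc).2 (Eventually.of_forall fun y hy => ?_)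
      have hy0 : 0 < y := hy.1
      have hmn : 0 ≤ min 1 (2 * y) := le_min zero_le_one (by positivity)
      rw [Real.norm_of_nonneg (by rw [smul_eq_mul]; positivity), smul_eq_mul, mul_left_comm, hpow y hy0]
      calc min 1 (2 * y) ^ q * y ^ (-1 - b) ≤ (2 * y) ^ q * y ^ (-1 - b) := by
            gcongr
            exact min_le_right _ _
        _ = 2 ^ q * y ^ (q - 1 - b) := by
            rw [Real.mul_rpow (by norm_num) hy0.le, mul_assoc, ← Real.rpow_add hy0]
            congr 2; ring
    · have h1 := integrableOn_Ioi_rpow_of_lt (show -1 - b < -1 by linarith) one_pos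
      refine Integrable.mono' h1 hm2.aestronglyMeasurable ?_
      refine (ae_restrict_iff' measurableSet_Ioi).2 (Eventually.of_forall fun y hy => ?_)
      have hy0 : 0 < y := lt_trans one_pos hy
      have hmn : 0 ≤ min 1 (2 * y) := le_min zero_le_one (by positivity)
      rw [Real.norm_of_nonneg (by rw [smul_eq_mul]; positivity), smul_eq_mul, mul_left_comm, hpow y hy0]
      calc min 1 (2 * y) ^ q * y ^ (-1 - b) ≤ 1 * y ^ (-1 - b) := by
            gcongr
            exact Real.rpow_le_one hmn (min_le_left _ _) hq.le
        _ = _ := one_mul _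
  have h2 := hI.hasFiniteIntegral
  unfold HasFiniteIntegral at h2
  refine ne_top_of_le_ne_top h2.ne (lintegral_mono fun z => ?_)
  exact Real.ofReal_le_enorm _

lemma lintegral_smul_comp {N : ℕ} {F : Euc N → ℝ≥0∞} (hF : Measurable F) {ρ : ℝ} (hρ : 0 < ρ) :
    ∫⁻ z, F (ρ⁻¹ • z) = ENNReal.ofReal (ρ ^ (N : ℝ)) * ∫⁻ z, F z := by
  have h := Measure.map_addHaar_smul (volume : Measure (Euc N)) (r := ρ⁻¹) (inv_pos.2 hρ).ne'
  rw [← lintegral_map (g := fun z => ρ⁻¹ • z) hF (measurable_const_smul _), h, lintegral_smul_measure, euc_finrank]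
  rw [smul_eq_mul, inv_pow, inv_inv, abs_of_pos (by positivity), Real.rpow_natCast]

/-- constant in the cutoff bound -/
def cK (N : ℕ) (q b : ℝ) : ℝ≥0∞ :=
  ∫⁻ z : Euc N, ENNReal.ofReal ((min 1 (2 * ‖z‖)) ^ q * (‖z‖ ^ ((N : ℝ) + b))⁻¹)

lemma measurable_cKi (N : ℕ) (q b : ℝ) : Measurable fun z : Euc N =>
    ENNReal.ofReal ((min 1 (2 * ‖z‖)) ^ q * (‖z‖ ^ ((N : ℝ) + b))⁻¹) :=
  ENNReal.measurable_ofReal.comp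
    (((measurable_const.min (measurable_norm.const_mul 2)).pow_const q).mul
      ((measurable_norm.pow_const _).inv))

lemma gg_cutoff {N : ℕ} {q b ε ρ : ℝ} (hq : 0 < q) (hρ : 0 < ρ) {χ : Euc N → ℝ}
    (hχ : ∀ x y, |χ x - χ y| ≤ min 1 (2 * ‖ρ⁻¹ • (x - y)‖)) (x : Euc N) :
    gg ε (N + b) q χ x ≤ ENNReal.ofReal (ρ ^ (-b)) * cK N q b := by
  have key : ∀ y, ‖χ x - χ y‖ₑ ^ q * kk ε (N + b) x y ≤ ENNReal.ofReal (ρ ^ (-((N : ℝ) + b))) *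
      (fun z : Euc N => ENNReal.ofReal ((min 1 (2 * ‖ρ⁻¹ • z‖)) ^ q *
        (‖ρ⁻¹ • z‖ ^ ((N : ℝ) + b))⁻¹)) (x - y) := by
    intro y
    have h1 : ‖χ x - χ y‖ₑ ^ q ≤ ENNReal.ofReal ((min 1 (2 * ‖ρ⁻¹ • (x - y)‖)) ^ q) := by
      rw [← ENNReal.ofReal_rpow_of_nonneg (le_min zero_le_one (by positivity)) hq.le]
      refine ENNReal.rpow_le_rpow ?_ hq.le
      rw [← ofReal_norm]
      exact ENNReal.ofReal_le_ofReal (hχ x y)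
    have h2 : kk ε (N + b) x y ≤ ENNReal.ofReal (ρ ^ (-((N : ℝ) + b))) *
        ENNReal.ofReal ((‖ρ⁻¹ • (x - y)‖ ^ ((N : ℝ) + b))⁻¹) := by
      rw [← ENNReal.ofReal_mul (by positivity)]
      have : (dist x y ^ ((N : ℝ) + b))⁻¹ = ρ ^ (-((N : ℝ) + b)) *
          (‖ρ⁻¹ • (x - y)‖ ^ ((N : ℝ) + b))⁻¹ := by
        rw [Real.rpow_neg hρ.le, ← mul_inv, ← Real.mul_rpow hρ.le (norm_nonneg _), norm_smul,
          Real.norm_of_nonneg (inv_pos.2 hρ).le, mul_inv_cancel_left₀ hρ.ne', dist_eq_norm]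
      rw [← this]
      unfold kk
      split_ifs
      · exact le_rfl
      · exact zero_le
    calc _ ≤ ENNReal.ofReal ((min 1 (2 * ‖ρ⁻¹ • (x - y)‖)) ^ q) * (ENNReal.ofReal (ρ ^ (-((N : ℝ) + b))) *
        ENNReal.ofReal ((‖ρ⁻¹ • (x - y)‖ ^ ((N : ℝ) + b))⁻¹)) := mul_le_mul' h1 h2
      _ = _ := by
        simp only
        rw [ENNReal.ofReal_mul (p := min 1 (2 * ‖ρ⁻¹ • (x - y)‖) ^ q)
          (Real.rpow_nonneg (le_min zero_le_one (by positivity)) _)]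
        ring
  unfold gg
  refine (lintegral_mono key).trans ?_
  rw [lintegral_const_mul' _ _ ENNReal.ofReal_ne_top,
    lintegral_sub_left_eq_self (fun z : Euc N => ENNReal.ofReal ((min 1 (2 * ‖ρ⁻¹ • z‖)) ^ q *
        (‖ρ⁻¹ • z‖ ^ ((N : ℝ) + b))⁻¹)) x,
    lintegral_smul_comp (measurable_cKi N q b) hρ, ← mul_assoc, ← ENNReal.ofReal_mul (by positivity),
    ← Real.rpow_add hρ, show -((N : ℝ) + b) + N = -b by ring]
  exact le_rfl

lemma lint2_add {N : ℕ} {f : Euc N → Euc N → ℝ≥0∞} (hf : Measurable (Function.uncurry f))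
    (g : Euc N → Euc N → ℝ≥0∞) :
    ∫⁻ x, ∫⁻ y, (f x y + g x y) = (∫⁻ x, ∫⁻ y, f x y) + ∫⁻ x, ∫⁻ y, g x y := by
  have h1 : Measurable fun x => ∫⁻ y, f x y := hf.lintegral_prod_right'
  rw [← lintegral_add_left h1]
  congr 1; funext x
  have h2 : Measurable fun y => f x y := hf.comp measurable_prodMk_left
  rw [lintegral_add_left h2]

lemma ind_left {N : ℕ} {B : Set (Euc N)} (hB : MeasurableSet B) (H : Euc N → Euc N → ℝ≥0∞) :
    ∫⁻ x, ∫⁻ y, B.indicator 1 x * H x y = ∫⁻ x in B, ∫⁻ y, H x y := by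
  rw [← lintegral_indicator hB]
  congr 1; funext x
  by_cases hx : x ∈ B <;> simp [hx]

lemma ind_right {N : ℕ} {B : Set (Euc N)} (hB : MeasurableSet B) {H : Euc N → Euc N → ℝ≥0∞}
    (hH : Measurable (Function.uncurry H)) :
    ∫⁻ x, ∫⁻ y, B.indicator 1 y * H x y = ∫⁻ y in B, ∫⁻ x, H x y := by
  rw [lintegral_lintegral_swap]
  · exact ind_left hB (fun y x => H x y)
  · exact (((measurable_one.indicator hB).comp measurable_snd).mul hH).aemeasurable

lemma gg_swap {N : ℕ} (ε a q : ℝ) (v : Euc N → ℝ) (y : Euc N) :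
    ∫⁻ x, ‖v x - v y‖ₑ ^ q * kk ε a x y = gg ε a q v y := by
  unfold gg
  congr 1; funext x
  rw [kk_symm, ← enorm_neg, neg_sub]

lemma weight_int {N : ℕ} {q a ε : ℝ} (hq : 0 < q) {χ : Euc N → ℝ} (hχm : Measurable χ)
    {B : Set (Euc N)} (hB : MeasurableSet B) (hχB : ∀ x, x ∉ B → χ x = 0) :
    ∫⁻ x, gg ε a q χ x ≤ 2 * ∫⁻ x in B, gg ε a q χ x := by
  have hm : Measurable (Function.uncurry fun x y : Euc N => ‖χ x - χ y‖ₑ ^ q * kk ε a x y) :=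
    measurable_ggi ε a q hχm
  have key : ∀ x y, ‖χ x - χ y‖ₑ ^ q * kk ε a x y ≤
      B.indicator 1 x * (‖χ x - χ y‖ₑ ^ q * kk ε a x y) +
      B.indicator 1 y * (‖χ x - χ y‖ₑ ^ q * kk ε a x y) := by
    intro x y
    by_cases hx : x ∈ B
    · simp [hx]
    · by_cases hy : y ∈ B
      · simp [hx, hy]
      · simp [hχB x hx, hχB y hy, hq]
  calc ∫⁻ x, gg ε a q χ x ≤ ∫⁻ x, ∫⁻ y, (B.indicator 1 x * (‖χ x - χ y‖ₑ ^ q * kk ε a x y) +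
      B.indicator 1 y * (‖χ x - χ y‖ₑ ^ q * kk ε a x y)) :=
        lintegral_mono fun x => lintegral_mono fun y => key x y
    _ = (∫⁻ x, ∫⁻ y, B.indicator 1 x * (‖χ x - χ y‖ₑ ^ q * kk ε a x y)) +
        ∫⁻ x, ∫⁻ y, B.indicator 1 y * (‖χ x - χ y‖ₑ ^ q * kk ε a x y) := by
        have m1 : Measurable fun z : Euc N × Euc N => B.indicator (1 : Euc N → ℝ≥0∞) z.1 *
            (‖χ z.1 - χ z.2‖ₑ ^ q * kk ε a z.1 z.2) :=
          ((measurable_one.indicator hB).comp measurable_fst).mul hm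
        exact lint2_add m1 _
    _ = _ := by
        rw [ind_left hB, ind_right hB hm, two_mul]
        simp only [gg_swap]
        rfl

lemma weight_D {N : ℕ} {q a ε : ℝ} (hq : 1 < q) {χ : Euc N → ℝ} (hχm : Measurable χ)
    (hχ1 : ∀ x y, |χ x - χ y| ≤ 1)
    {B : Set (Euc N)} (hB : MeasurableSet B) (hχB : ∀ x, x ∉ B → χ x = 0)
    {v : Euc N → ℝ} (hv : Measurable v) :
    ∫⁻ x, ‖v x‖ₑ ^ q * gg ε a q χ x ≤ (∫⁻ x in B, ‖v x‖ₑ ^ q * gg ε a q χ x) +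
      2 ^ (q - 1) * ((∫⁻ x in B, gg ε a q v x) + ∫⁻ x in B, ‖v x‖ₑ ^ q * gg ε a q χ x) := by
  have hm := measurable_ggi ε a q hχm
  have hmv := measurable_ggi ε a q hv
  have h2t : (2 : ℝ≥0∞) ^ (q - 1) ≠ ⊤ := ENNReal.rpow_ne_top_of_nonneg (by linarith) (by simp)
  have hq0 : 0 < q := by linarith
  have m1 : Measurable fun z : Euc N × Euc N => B.indicator (1 : Euc N → ℝ≥0∞) z.1 *
      (‖v z.1‖ₑ ^ q * (‖χ z.1 - χ z.2‖ₑ ^ q * kk ε a z.1 z.2)) :=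
    ((measurable_one.indicator hB).comp measurable_fst).mul
      (((hv.comp measurable_fst).enorm.pow_const q).mul hm)
  have m2 : Measurable (Function.uncurry fun x y : Euc N => ‖v x - v y‖ₑ ^ q * kk ε a x y +
      ‖v y‖ₑ ^ q * (‖χ x - χ y‖ₑ ^ q * kk ε a x y)) :=
    hmv.add (((hv.comp measurable_snd).enorm.pow_const q).mul hm)
  have key : ∀ x y, ‖v x‖ₑ ^ q * (‖χ x - χ y‖ₑ ^ q * kk ε a x y) ≤
      B.indicator 1 x * (‖v x‖ₑ ^ q * (‖χ x - χ y‖ₑ ^ q * kk ε a x y)) +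
      2 ^ (q - 1) * (B.indicator 1 y * (‖v x - v y‖ₑ ^ q * kk ε a x y +
        ‖v y‖ₑ ^ q * (‖χ x - χ y‖ₑ ^ q * kk ε a x y))) := by
    intro x y
    by_cases hx : x ∈ B
    · simp [hx]
    · by_cases hy : y ∈ B
      · simp only [hx, hy, not_false_eq_true, indicator_of_notMem, indicator_of_mem, Pi.one_apply,
          one_mul, zero_mul, zero_add]
        have hc : ‖χ x - χ y‖ₑ ^ q ≤ 1 := by
          refine ENNReal.rpow_le_one ?_ hq0.le
          rw [← ofReal_norm]
          exact (ENNReal.ofReal_le_ofReal (hχ1 x y)).trans (by simp)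
        have h3 : ‖v x‖ₑ ^ q ≤ 2 ^ (q - 1) * (‖v x - v y‖ₑ ^ q + ‖v y‖ₑ ^ q) := by
          refine le_trans ?_ (ENNReal.rpow_add_le_mul_rpow_add_rpow _ _ hq.le)
          refine ENNReal.rpow_le_rpow ?_ hq0.le
          conv_lhs => rw [show v x = (v x - v y) + v y by ring]
          exact enorm_add_le _ _
        calc _ ≤ (2 ^ (q - 1) * (‖v x - v y‖ₑ ^ q + ‖v y‖ₑ ^ q)) *
              (‖χ x - χ y‖ₑ ^ q * kk ε a x y) := by gcongr
          _ = 2 ^ (q - 1) * (‖v x - v y‖ₑ ^ q * (‖χ x - χ y‖ₑ ^ q * kk ε a x y) +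
              ‖v y‖ₑ ^ q * (‖χ x - χ y‖ₑ ^ q * kk ε a x y)) := by ring
          _ ≤ 2 ^ (q - 1) * (‖v x - v y‖ₑ ^ q * (1 * kk ε a x y) +
              ‖v y‖ₑ ^ q * (‖χ x - χ y‖ₑ ^ q * kk ε a x y)) := by gcongr
          _ = _ := by rw [one_mul]
      · simp [hχB x hx, hχB y hy, hq0]
  have eL : ∀ x, ‖v x‖ₑ ^ q * gg ε a q χ x =
      ∫⁻ y, ‖v x‖ₑ ^ q * (‖χ x - χ y‖ₑ ^ q * kk ε a x y) := by
    intro x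
    unfold gg
    rw [lintegral_const_mul]
    exact hm.comp measurable_prodMk_left
  have eR : ∀ y, ‖v y‖ₑ ^ q * gg ε a q χ y =
      ∫⁻ x, ‖v y‖ₑ ^ q * (‖χ x - χ y‖ₑ ^ q * kk ε a x y) := by
    intro y
    rw [← gg_swap, lintegral_const_mul]
    exact hm.comp measurable_prodMk_right
  calc ∫⁻ x, ‖v x‖ₑ ^ q * gg ε a q χ x
      ≤ ∫⁻ x, ∫⁻ y, (B.indicator 1 x * (‖v x‖ₑ ^ q * (‖χ x - χ y‖ₑ ^ q * kk ε a x y)) +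
      2 ^ (q - 1) * (B.indicator 1 y * (‖v x - v y‖ₑ ^ q * kk ε a x y +
        ‖v y‖ₑ ^ q * (‖χ x - χ y‖ₑ ^ q * kk ε a x y)))) := by
        refine lintegral_mono fun x => ?_
        simp only [eL]
        exact lintegral_mono fun y => key x y
    _ = (∫⁻ x, ∫⁻ y, B.indicator 1 x * (‖v x‖ₑ ^ q * (‖χ x - χ y‖ₑ ^ q * kk ε a x y))) +
        2 ^ (q - 1) * ∫⁻ x, ∫⁻ y, B.indicator 1 y * (‖v x - v y‖ₑ ^ q * kk ε a x y +
        ‖v y‖ₑ ^ q * (‖χ x - χ y‖ₑ ^ q * kk ε a x y)) := by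
        rw [← lintegral_const_mul' _ _ h2t]
        simp only [← lintegral_const_mul' _ _ h2t]
        exact lint2_add m1 _
    _ = _ := by
        rw [ind_left hB, ind_right hB m2]
        congr 1
        · congr 1; funext x; exact (eL x).symm
        · congr 1
          rw [← lintegral_add_left (measurable_gg ε a q hv)]
          congr 1; funext y
          have h5 : Measurable fun x => ‖v x - v y‖ₑ ^ q * kk ε a x y :=
            hmv.comp measurable_prodMk_right
          rw [lintegral_add_left h5, gg_swap, eR]

/-- the integrand of the statement -/
def FF {N : ℕ} (s : ℝ) (p : Euc N → Euc N → ℝ) (χ u : Euc N → ℝ) (x y : Euc N) : ℝ≥0∞ :=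
  ENNReal.ofReal (|u x| ^ p x y * |χ x - χ y| ^ p x y / dist x y ^ ((N : ℝ) + s * p x y))

lemma enorm_rpow_eq {q : ℝ} (hq : 0 ≤ q) (t : ℝ) : ENNReal.ofReal (|t| ^ q) = ‖t‖ₑ ^ q := by
  rw [← ENNReal.ofReal_rpow_of_nonneg (abs_nonneg t) hq, ← ofReal_norm, Real.norm_eq_abs]

lemma FF_near {N : ℕ} {s q ε : ℝ} {p : Euc N → Euc N → ℝ} (hq : 0 < q) (χ u : Euc N → ℝ)
    {x y : Euc N} (hxy : dist x y < ε) (hp : p x y = q) :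
    FF s p χ u x y = ‖u x‖ₑ ^ q * (‖χ x - χ y‖ₑ ^ q * kk ε (N + s * q) x y) := by
  unfold FF kk
  rw [if_pos hxy, hp, ← enorm_rpow_eq hq.le, ← enorm_rpow_eq hq.le, ← ENNReal.ofReal_mul (by positivity),
    ← ENNReal.ofReal_mul (by positivity), div_eq_mul_inv, mul_assoc]

lemma kern_ineq {N : ℕ} {s q pm ε d t : ℝ} (hs : 0 < s) (hpm : 0 < pm) (h1 : pm ≤ t) (h2 : t ≤ q)
    (hε : 0 < ε) (hε2 : ε < 1 / 2) (hd : ε ≤ d) :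
    (d ^ ((N : ℝ) + s * t))⁻¹ ≤ ((2 * ε) ^ pm * ε ^ (s * (q - pm)))⁻¹ *
      ((min 1 (2 * d)) ^ pm * (d ^ ((N : ℝ) + s * pm))⁻¹) := by
  have hd0 : 0 < d := by linarith
  have e1 : d ^ ((N : ℝ) + s * t) = d ^ (s * (t - pm)) * d ^ ((N : ℝ) + s * pm) := by
    rw [← Real.rpow_add hd0]; congr 1; ring
  have e2 : ε ^ (s * (q - pm)) ≤ d ^ (s * (t - pm)) := by
    calc ε ^ (s * (q - pm)) ≤ ε ^ (s * (t - pm)) :=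
          Real.rpow_le_rpow_of_exponent_ge hε (by linarith) (by nlinarith)
      _ ≤ d ^ (s * (t - pm)) := Real.rpow_le_rpow hε.le hd (mul_nonneg hs.le (by linarith))
  have e3 : (2 * ε) ^ pm ≤ (min 1 (2 * d)) ^ pm :=
    Real.rpow_le_rpow (by positivity) (le_min (by linarith) (by linarith)) hpm.le
  have p1 : 0 < ε ^ (s * (q - pm)) := Real.rpow_pos_of_pos hε _
  have p2 : 0 < (2 * ε) ^ pm := Real.rpow_pos_of_pos (by positivity) _
  rw [e1, mul_inv, mul_inv, ← mul_assoc]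
  gcongr
  calc (d ^ (s * (t - pm)))⁻¹ ≤ (ε ^ (s * (q - pm)))⁻¹ := by gcongr
    _ = ((2 * ε) ^ pm)⁻¹ * (ε ^ (s * (q - pm)))⁻¹ * (2 * ε) ^ pm := by field_simp
    _ ≤ _ := by gcongr

lemma rpow_le_one_add {t p q : ℝ} (ht : 0 ≤ t) (hp : 0 < p) (hpq : p ≤ q) : t ^ p ≤ 1 + t ^ q := by
  rcases le_total t 1 with h | h
  · have := Real.rpow_le_one ht h hp.le
    have := Real.rpow_nonneg ht q
    linarith
  · have := Real.rpow_le_rpow_of_exponent_le h hpq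
    linarith

lemma FF_far {N : ℕ} {s q pm ε : ℝ} {p : Euc N → Euc N → ℝ} (hs : 0 < s) (hpm : 0 < pm)
    {χ u : Euc N → ℝ} {x y : Euc N} (h1 : pm ≤ p x y) (h2 : p x y ≤ q)
    (hε : 0 < ε) (hε2 : ε < 1 / 2) (hd : ε ≤ dist x y) (hχ : |χ x - χ y| ≤ 1) :
    FF s p χ u x y ≤ (1 + ‖u x‖ₑ ^ q) * (ENNReal.ofReal (((2 * ε) ^ pm * ε ^ (s * (q - pm)))⁻¹) *
      ENNReal.ofReal ((min 1 (2 * ‖x - y‖)) ^ pm * (‖x - y‖ ^ ((N : ℝ) + s * pm))⁻¹)) ∧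
    ENNReal.ofReal (((2 * ε) ^ pm * ε ^ (s * (q - pm)))⁻¹) *
      ENNReal.ofReal ((min 1 (2 * ‖x - y‖)) ^ pm * (‖x - y‖ ^ ((N : ℝ) + s * pm))⁻¹) ≤
      ENNReal.ofReal (((2 * ε) ^ pm * ε ^ (s * (q - pm)))⁻¹) *
        ENNReal.ofReal ((ε ^ ((N : ℝ) + s * pm))⁻¹) := by
  have hd0 : 0 < dist x y := by linarith
  have hp0 : 0 < p x y := by linarith
  have hm0 : 0 ≤ min 1 (2 * ‖x - y‖) := le_min zero_le_one (by positivity)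
  constructor
  · rw [← enorm_rpow_eq (by linarith), ← ENNReal.ofReal_one, ← ENNReal.ofReal_add (by norm_num)
      (by positivity), ← ENNReal.ofReal_mul (by positivity), ← ENNReal.ofReal_mul (by positivity)]
    unfold FF
    apply ENNReal.ofReal_le_ofReal
    have hk := kern_ineq (N := N) hs hpm h1 h2 hε hε2 hd
    rw [dist_eq_norm] at hk ⊢
    rw [div_eq_mul_inv]
    have h4 : |χ x - χ y| ^ p x y ≤ 1 := Real.rpow_le_one (abs_nonneg _) hχ hp0.le
    have h5 := rpow_le_one_add (abs_nonneg (u x)) hp0 h2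
    calc _ ≤ ((1 + |u x| ^ q) * 1) * (‖x - y‖ ^ ((N : ℝ) + s * p x y))⁻¹ := by gcongr
      _ ≤ _ := by rw [mul_one]; gcongr
  · gcongr
    rw [← one_mul (ε ^ ((N : ℝ) + s * pm))⁻¹]
    rw [dist_eq_norm] at hd
    gcongr
    exact Real.rpow_le_one hm0 (min_le_left _ _) hpm.le

lemma main_bound {N : ℕ} (hN : 0 < N) {s q pm ε : ℝ} {p : Euc N → Euc N → ℝ} (hs : 0 < s)
    (hs1 : s < 1) (hpm : 1 < pm) (h1 : ∀ x y, pm ≤ p x y) (h2 : ∀ x y, p x y ≤ q)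
    (hε : 0 < ε) (hε2 : ε < 1 / 2) (hdiag : ∀ x y, dist x y < ε → p x y = q) :
    ∃ K : ℝ≥0∞, K ≠ ⊤ ∧ ∀ (χ u : Euc N → ℝ) (B : Set (Euc N)), Measurable χ → Measurable u →
      MeasurableSet B → (∀ x y, |χ x - χ y| ≤ 1) → (∀ x, x ∉ B → χ x = 0) →
      ∫⁻ x, ∫⁻ y, FF s p χ u x y ≤ (∫⁻ x, ‖u x‖ₑ ^ q * gg ε (N + s * q) q χ x) +
        K * ((∫⁻ x in B, ‖u x‖ₑ ^ q) + volume B * (2 + ∫⁻ x, ‖u x‖ₑ ^ q)) := by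
  have hq1 : 1 < q := by linarith [h1 0 0, h2 0 0]
  have hq0 : 0 < q := by linarith
  set c0 := ENNReal.ofReal (((2 * ε) ^ pm * ε ^ (s * (q - pm)))⁻¹) with hc0
  set K1 := c0 * ENNReal.ofReal ((ε ^ ((N : ℝ) + s * pm))⁻¹) with hK1
  set κ : Euc N → ℝ≥0∞ := fun z => c0 * ENNReal.ofReal ((min 1 (2 * ‖z‖)) ^ pm *
    (‖z‖ ^ ((N : ℝ) + s * pm))⁻¹) with hκ
  have hκm : Measurable κ := (measurable_cKi N pm (s * pm)).const_mul c0
  set K2 := ∫⁻ z, κ z with hK2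
  have hK2t : K2 ≠ ⊤ := by
    rw [hK2, hκ, lintegral_const_mul' _ _ ENNReal.ofReal_ne_top]
    exact ENNReal.mul_ne_top ENNReal.ofReal_ne_top (kern_fin hN (by positivity) (by nlinarith))
  refine ⟨K1 + K2, ENNReal.add_ne_top.2 ⟨ENNReal.mul_ne_top ENNReal.ofReal_ne_top
    ENNReal.ofReal_ne_top, hK2t⟩, ?_⟩
  intro χ u B hχm hum hB hχ1 hχB
  have hm := measurable_ggi ε (N + s * q) q hχm
  have huq : Measurable fun x => ‖u x‖ₑ ^ q := hum.enorm.pow_const q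
  have hκ2 : Measurable fun z : Euc N × Euc N => κ (z.1 - z.2) :=
    hκm.comp (measurable_fst.sub measurable_snd)
  have key : ∀ x y, FF s p χ u x y ≤
      ‖u x‖ₑ ^ q * (‖χ x - χ y‖ₑ ^ q * kk ε (N + s * q) x y) +
      (B.indicator 1 x * ((1 + ‖u x‖ₑ ^ q) * κ (x - y)) +
       B.indicator 1 y * (κ (x - y) + ‖u x‖ₑ ^ q * K1)) := by
    intro x y
    by_cases hd : dist x y < ε
    · rw [FF_near hq0 χ u hd (hdiag x y hd)]
      exact le_self_add
    · obtain ⟨f1, f2⟩ := FF_far (u := u) hs (by linarith : 0 < pm) (h1 x y) (h2 x y) hε hε2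
        (not_lt.1 hd) (hχ1 x y)
      refine le_trans ?_ le_add_self
      by_cases hx : x ∈ B
      · refine le_trans ?_ le_self_add
        simp only [hx, indicator_of_mem, Pi.one_apply, one_mul]
        exact f1
      · by_cases hy : y ∈ B
        · refine le_trans ?_ le_add_self
          simp only [hy, indicator_of_mem, Pi.one_apply, one_mul]
          refine f1.trans ?_
          rw [add_mul, one_mul]
          gcongr
        · unfold FF
          have : p x y ≠ 0 := by linarith [h1 x y]
          simp [hχB x hx, hχB y hy, Real.zero_rpow this]
  have m1 : Measurable (Function.uncurry fun x y : Euc N =>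
      ‖u x‖ₑ ^ q * (‖χ x - χ y‖ₑ ^ q * kk ε (N + s * q) x y)) :=
    (huq.comp measurable_fst).mul hm
  have m2 : Measurable (Function.uncurry fun x y : Euc N =>
      B.indicator (1 : Euc N → ℝ≥0∞) x * ((1 + ‖u x‖ₑ ^ q) * κ (x - y))) :=
    ((measurable_one.indicator hB).comp measurable_fst).mul
      ((measurable_const.add (huq.comp measurable_fst)).mul hκ2)
  have m3 : Measurable (Function.uncurry fun x y : Euc N => κ (x - y) + ‖u x‖ₑ ^ q * K1) :=
    hκ2.add ((huq.comp measurable_fst).mul_const _)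
  have i1 : ∀ x, ∫⁻ y, κ (x - y) = K2 := fun x => lintegral_sub_left_eq_self κ x
  have i2 : ∀ y, ∫⁻ x, κ (x - y) = K2 := fun y => lintegral_sub_right_eq_self κ y
  refine (lintegral_mono fun x => lintegral_mono fun y => key x y).trans ?_
  rw [lint2_add m1, lint2_add m2, ind_left hB, ind_right hB m3]
  refine add_le_add (le_of_eq ?_) ?_
  · congr 1; funext x
    unfold gg
    rw [lintegral_const_mul]
    exact hm.comp measurable_prodMk_left
  · have j1 : ∫⁻ x in B, ∫⁻ y, (1 + ‖u x‖ₑ ^ q) * κ (x - y) =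
        (volume B + ∫⁻ x in B, ‖u x‖ₑ ^ q) * K2 := by
      have : ∀ x, ∫⁻ y, (1 + ‖u x‖ₑ ^ q) * κ (x - y) = (1 + ‖u x‖ₑ ^ q) * K2 := by
        intro x
        have hy : Measurable fun y => κ (x - y) := hκm.comp (measurable_const.sub measurable_id)
        rw [lintegral_const_mul _ hy, i1]
      simp only [this]
      have h6 : Measurable fun x => 1 + ‖u x‖ₑ ^ q := measurable_const.add huq
      rw [lintegral_mul_const _ h6, lintegral_add_right _ huq]
      simp
    have j2 : ∫⁻ y in B, ∫⁻ x, (κ (x - y) + ‖u x‖ₑ ^ q * K1) =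
        (K2 + (∫⁻ x, ‖u x‖ₑ ^ q) * K1) * volume B := by
      have : ∀ y, ∫⁻ x, (κ (x - y) + ‖u x‖ₑ ^ q * K1) = K2 + (∫⁻ x, ‖u x‖ₑ ^ q) * K1 := by
        intro y
        rw [lintegral_add_right _ (huq.mul_const _), i2, lintegral_mul_const _ huq]
      simp only [this]
      rw [setLIntegral_const]
    rw [j1, j2]
    set U := ∫⁻ x, ‖u x‖ₑ ^ q
    set A := ∫⁻ x in B, ‖u x‖ₑ ^ q
    calc (volume B + A) * K2 + (K2 + U * K1) * volume B
        = K2 * (A + volume B * 2) + K1 * (volume B * U) := by ring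
      _ ≤ (K1 + K2) * (A + volume B * (2 + U)) + 0 := by
          rw [add_zero, add_mul, add_comm (K1 * _)]
          gcongr
          · exact le_self_add
          · exact le_add_left (by gcongr; exact le_add_self)
      _ = _ := add_zero _

lemma enorm_add_pow_le {q : ℝ} (hq : 1 < q) (s t : ℝ) :
    ‖s + t‖ₑ ^ q ≤ 2 ^ (q - 1) * (‖s‖ₑ ^ q + ‖t‖ₑ ^ q) :=
  (ENNReal.rpow_le_rpow (enorm_add_le _ _) (by linarith)).trans
    (ENNReal.rpow_add_le_mul_rpow_add_rpow _ _ hq.le)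

lemma gg_sub_le {N : ℕ} {ε a q : ℝ} (hq : 1 < q) {f g : Euc N → ℝ} (hf : Measurable f)
    (x : Euc N) :
    gg ε a q (fun x => f x - g x) x ≤ 2 ^ (q - 1) * (gg ε a q f x + gg ε a q g x) := by
  have h2t : (2 : ℝ≥0∞) ^ (q - 1) ≠ ⊤ := ENNReal.rpow_ne_top_of_nonneg (by linarith) (by simp)
  unfold gg
  have hm : Measurable fun y => ‖f x - f y‖ₑ ^ q * kk ε a x y :=
    (measurable_ggi ε a q hf).comp measurable_prodMk_left
  rw [← lintegral_add_left hm, ← lintegral_const_mul' _ _ h2t]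
  refine lintegral_mono fun y => ?_
  have := enorm_add_pow_le hq (f x - f y) (-(g x - g y))
  rw [enorm_neg] at this
  calc ‖f x - g x - (f y - g y)‖ₑ ^ q * kk ε a x y
      = ‖(f x - f y) + -(g x - g y)‖ₑ ^ q * kk ε a x y := by congr 3; ring
    _ ≤ (2 ^ (q - 1) * (‖f x - f y‖ₑ ^ q + ‖g x - g y‖ₑ ^ q)) * kk ε a x y := by gcongr
    _ = _ := by ring


lemma phi_split {N : ℕ} {f G : Euc N → ℝ≥0∞} (hf : Measurable f) (hG : Measurable G)
    {B : Set (Euc N)} (hB : MeasurableSet B) {K : ℝ≥0∞} (hK : K ≠ ⊤) :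
    ∫⁻ x, f x * (G x + K * B.indicator 1 x) = (∫⁻ x, f x * G x) + K * ∫⁻ x in B, f x := by
  have e : ∀ x, f x * (G x + K * B.indicator 1 x) = f x * G x + K * B.indicator f x := by
    intro x
    by_cases hx : x ∈ B
    · simp only [hx, indicator_of_mem, Pi.one_apply]; ring
    · simp [hx]
  simp only [e]
  have hm : Measurable fun x => f x * G x := hf.mul hG
  rw [lintegral_add_left hm, lintegral_const_mul' _ _ hK, lintegral_indicator hB]

lemma inner_limsup {N : ℕ} (hN : 0 < N) {s q ε ρ : ℝ} {p : Euc N → Euc N → ℝ} (hs : 0 < s)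
    (hs1 : s < 1) (hq : 1 < q) (hε : 0 < ε) (hρ : 0 < ρ) {K : ℝ≥0∞} (hKt : K ≠ ⊤)
    (hK : ∀ (χ u : Euc N → ℝ) (B : Set (Euc N)), Measurable χ → Measurable u →
      MeasurableSet B → (∀ x y, |χ x - χ y| ≤ 1) → (∀ x, x ∉ B → χ x = 0) →
      ∫⁻ x, ∫⁻ y, FF s p χ u x y ≤ (∫⁻ x, ‖u x‖ₑ ^ q * gg ε (N + s * q) q χ x) +
        K * ((∫⁻ x in B, ‖u x‖ₑ ^ q) + volume B * (2 + ∫⁻ x, ‖u x‖ₑ ^ q)))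
    {vn : ℕ → Euc N → ℝ} {v : Euc N → ℝ} (hvn : ∀ n, Measurable (vn n)) (hv : Measurable v)
    {M : ℝ≥0∞} (hMt : M ≠ ⊤) (hM1 : ∀ n, ∫⁻ x, ‖vn n x‖ₑ ^ q ≤ M)
    (hM2 : ∀ n, ∫⁻ x, gg ε (N + s * q) q (vn n) x ≤ M)
    (hv1 : ∫⁻ x, ‖v x‖ₑ ^ q ≤ M) (hv2 : ∫⁻ x, gg ε (N + s * q) q v x ≤ M)
    (hconv : ∀ (x : Euc N) (h : ℝ), 0 < h → Tendsto (fun n => ∫ y in Metric.ball x h, vn n y)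
      atTop (𝓝 (∫ y in Metric.ball x h, v y)))
    {χ : Euc N → ℝ} (hχm : Measurable χ)
    (hχ : ∀ x y : Euc N, |χ x - χ y| ≤ min 1 (2 * ‖ρ⁻¹ • (x - y)‖))
    {B : Set (Euc N)} (hB : MeasurableSet B) (hBt : volume B ≠ ⊤)
    (hχB : ∀ x, x ∉ B → χ x = 0) :
    limsup (fun n => ∫⁻ x, ∫⁻ y, FF s p χ (vn n) x y) atTop ≤
      2 ^ (q - 1) * ((∫⁻ x, ‖v x‖ₑ ^ q * gg ε (N + s * q) q χ x) + K * ∫⁻ x in B, ‖v x‖ₑ ^ q) +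
        K * (volume B * (2 + M)) := by
  have hq0 : 0 < q := by linarith
  have h2t : (2 : ℝ≥0∞) ^ (q - 1) ≠ ⊤ := ENNReal.rpow_ne_top_of_nonneg (by linarith) (by simp)
  have hGm := measurable_gg ε (N + s * q) q hχm
  have hcK : cK N q (s * q) ≠ ⊤ := kern_fin hN (by positivity) (by nlinarith)
  set C0 := ENNReal.ofReal (ρ ^ (-(s * q))) * cK N q (s * q) with hC0
  have hC0t : C0 ≠ ⊤ := ENNReal.mul_ne_top ENNReal.ofReal_ne_top hcK
  have hGC : ∀ x, gg ε (N + s * q) q χ x ≤ C0 := gg_cutoff hq0 hρ hχ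
  set Φ : Euc N → ℝ≥0∞ := fun x => gg ε (N + s * q) q χ x + K * B.indicator 1 x with hΦ
  have hΦm : Measurable Φ := hGm.add ((measurable_one.indicator hB).const_mul K)
  have hΦC : ∀ x, Φ x ≤ C0 + K := by
    intro x
    refine add_le_add (hGC x) ?_
    calc K * B.indicator 1 x ≤ K * 1 := by
          gcongr
          exact indicator_le_self B 1 x
      _ = K := mul_one K
  have hGi : ∫⁻ x, gg ε (N + s * q) q χ x ≠ ⊤ := by
    refine ne_top_of_le_ne_top ?_ (weight_int hq0 hχm hB hχB)
    refine ENNReal.mul_ne_top (by simp) ?_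
    refine ne_top_of_le_ne_top ?_ (lintegral_mono fun x => hGC x)
    rw [setLIntegral_const]
    exact ENNReal.mul_ne_top hC0t hBt
  have hΦi : ∫⁻ x, Φ x ≠ ⊤ := by
    have := phi_split (f := fun _ => 1) measurable_const hGm hB hKt
    simp only [one_mul, setLIntegral_const] at this
    rw [hΦ, this]
    exact ENNReal.add_ne_top.2 ⟨hGi, ENNReal.mul_ne_top hKt hBt⟩
  set w : ℕ → Euc N → ℝ := fun n x => vn n x - v x with hw
  have hwm : ∀ n, Measurable (w n) := fun n => (hvn n).sub hv
  have hpw : ∀ f : Euc N → ℝ, Measurable f → Measurable fun x => ‖f x‖ₑ ^ q :=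
    fun f hf => hf.enorm.pow_const q
  have hMt2 : 2 ^ (q - 1) * (M + M) ≠ ⊤ := ENNReal.mul_ne_top h2t (ENNReal.add_ne_top.2 ⟨hMt, hMt⟩)
  have hlim : Tendsto (fun n => ∫⁻ x, ‖w n x‖ₑ ^ q * Φ x) atTop (𝓝 0) := by
    refine conv_weight (M := 2 ^ (q - 1) * (M + M)) (a := N + s * q) hq
      (by have := mul_pos hs hq0; linarith) hε hwm hMt2
      (fun n => ?_) (fun n => ?_) (fun x h hh => ?_) hΦm
      (ENNReal.add_ne_top.2 ⟨hC0t, hKt⟩) hΦC hΦi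
    · calc ∫⁻ x, ‖w n x‖ₑ ^ q ≤ ∫⁻ x, 2 ^ (q - 1) * (‖vn n x‖ₑ ^ q + ‖v x‖ₑ ^ q) := by
            refine lintegral_mono fun x => ?_
            have := enorm_add_pow_le hq (vn n x) (-(v x))
            rw [enorm_neg] at this
            exact this
        _ ≤ _ := by
            rw [lintegral_const_mul' _ _ h2t, lintegral_add_left (hpw _ (hvn n))]
            gcongr
            exact hM1 n
    · calc ∫⁻ x, gg ε (N + s * q) q (w n) x ≤
          ∫⁻ x, 2 ^ (q - 1) * (gg ε (N + s * q) q (vn n) x + gg ε (N + s * q) q v x) :=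
            lintegral_mono fun x => gg_sub_le hq (hvn n) x
        _ ≤ _ := by
            rw [lintegral_const_mul' _ _ h2t, lintegral_add_left (measurable_gg _ _ _ (hvn n))]
            gcongr
            exact hM2 n
    · have e : ∀ n, ∫ y in Metric.ball x h, w n y =
          (∫ y in Metric.ball x h, vn n y) - ∫ y in Metric.ball x h, v y := fun n =>
        integral_sub
          (integrableOn_of_Lq hq (hvn n).aestronglyMeasurable
            (ne_top_of_le_ne_top hMt (hM1 n)) x h)
          (integrableOn_of_Lq hq hv.aestronglyMeasurable (ne_top_of_le_ne_top hMt hv1) x h)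
      simp only [e]
      have := (hconv x h hh).sub_const (∫ y in Metric.ball x h, v y)
      rwa [sub_self] at this
  have hbd : ∀ n, ∫⁻ x, ∫⁻ y, FF s p χ (vn n) x y ≤
      2 ^ (q - 1) * (∫⁻ x, ‖w n x‖ₑ ^ q * Φ x) + (2 ^ (q - 1) * (∫⁻ x, ‖v x‖ₑ ^ q * Φ x) +
        K * (volume B * (2 + M))) := by
    intro n
    refine (hK χ (vn n) B hχm (hvn n) hB (fun x y => (hχ x y).trans (min_le_left _ _)) hχB).trans ?_
    rw [mul_add K, ← add_assoc, ← phi_split (hpw _ (hvn n)) hGm hB hKt, ← add_assoc]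
    refine add_le_add ?_ (by gcongr; exact hM1 n)
    have hm : Measurable fun x => ‖w n x‖ₑ ^ q * Φ x := (hpw _ (hwm n)).mul hΦm
    rw [← mul_add, ← lintegral_add_left hm, ← lintegral_const_mul' _ _ h2t]
    refine lintegral_mono fun x => ?_
    have := enorm_add_pow_le hq (w n x) (v x)
    have e : w n x + v x = vn n x := by simp [hw]
    rw [e] at this
    calc ‖vn n x‖ₑ ^ q * Φ x ≤ (2 ^ (q - 1) * (‖w n x‖ₑ ^ q + ‖v x‖ₑ ^ q)) * Φ x := by gcongr
      _ = _ := by ring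
  have hlim2 := (ENNReal.Tendsto.const_mul hlim (Or.inr h2t)).add_const
    (2 ^ (q - 1) * (∫⁻ x, ‖v x‖ₑ ^ q * Φ x) + K * (volume B * (2 + M)))
  refine (limsup_le_limsup (Eventually.of_forall hbd)).trans ?_
  rw [hlim2.limsup_eq, mul_zero, zero_add, hΦ, phi_split (hpw _ hv) hGm hB hKt]

lemma core {N : ℕ} (hN : 0 < N) {s q pm ε : ℝ} {p : Euc N → Euc N → ℝ} (hs : 0 < s)
    (hs1 : s < 1) (hpm : 1 < pm) (h1 : ∀ x y, pm ≤ p x y) (h2 : ∀ x y, p x y ≤ q)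
    (hsq : s * q < N)
    (hε : 0 < ε) (hε2 : ε < 1 / 2) (hdiag : ∀ x y, dist x y < ε → p x y = q)
    {vn : ℕ → Euc N → ℝ} {v : Euc N → ℝ} (hvn : ∀ n, Measurable (vn n)) (hv : Measurable v)
    {M : ℝ≥0∞} (hMt : M ≠ ⊤) (hM1 : ∀ n, ∫⁻ x, ‖vn n x‖ₑ ^ q ≤ M)
    (hM2 : ∀ n, ∫⁻ x, gg ε (N + s * q) q (vn n) x ≤ M)
    (hv1 : ∫⁻ x, ‖v x‖ₑ ^ q ≤ M) (hv2 : ∫⁻ x, gg ε (N + s * q) q v x ≤ M)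
    (hconv : ∀ (x : Euc N) (h : ℝ), 0 < h → Tendsto (fun n => ∫ y in Metric.ball x h, vn n y)
      atTop (𝓝 (∫ y in Metric.ball x h, v y)))
    (x₀ : Euc N) (ψ : Euc N → ℝ)
    (hψsm : ContDiff ℝ (⊤ : ℕ∞) ψ) (hψ0 : ∀ x, 0 ≤ ψ x) (hψ1 : ∀ x, ψ x ≤ 1)
    (hψsupp : tsupport ψ ⊆ Metric.ball (0 : Euc N) 2)
    (hψgrad : ∀ x, ‖fderiv ℝ ψ x‖ ≤ 2) :
    limsup (fun ρ : ℝ => limsup (fun n => ∫⁻ x, ∫⁻ y,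
      FF s p (fun x => ψ (ρ⁻¹ • (x - x₀))) (vn n) x y) atTop) (𝓝[>] (0 : ℝ)) = 0 := by
  have hq : 1 < q := by linarith [h1 0 0, h2 0 0]
  have hq0 : 0 < q := by linarith
  have hb : 0 < s * q := mul_pos hs hq0
  have h2t : (2 : ℝ≥0∞) ^ (q - 1) ≠ ⊤ := ENNReal.rpow_ne_top_of_nonneg (by linarith) (by simp)
  have hcK : cK N q (s * q) ≠ ⊤ := kern_fin hN hb (by nlinarith)
  obtain ⟨K, hKt, hK⟩ := main_bound hN hs hs1 hpm h1 h2 hε hε2 hdiag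
  have hlip : LipschitzWith 2 ψ := by
    refine lipschitzWith_of_nnnorm_fderiv_le (𝕜 := ℝ) (hψsm.differentiable (by simp)) fun x => ?_
    have := hψgrad x
    rw [← NNReal.coe_le_coe]
    simpa using this
  have hv1t : ∫⁻ x, ‖v x‖ₑ ^ q ≠ ⊤ := ne_top_of_le_ne_top hMt hv1
  have hv2t : ∫⁻ x, gg ε (N + s * q) q v x ≠ ⊤ := ne_top_of_le_ne_top hMt hv2
  set cc := cK N q (s * q) * ENNReal.ofReal (2 ^ (s * q)) with hcc
  have hcct : cc ≠ ⊤ := ENNReal.mul_ne_top hcK ENNReal.ofReal_ne_top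
  set A : ℝ → ℝ≥0∞ := fun ρ => cc * (ENNReal.ofReal ((2 * ρ) ^ (-(s * q))) *
    ∫⁻ x in Metric.ball x₀ (2 * ρ), ‖v x‖ₑ ^ q) with hA
  set R : ℝ → ℝ≥0∞ := fun ρ => 2 ^ (q - 1) * ((A ρ + 2 ^ (q - 1) *
      ((∫⁻ x in Metric.ball x₀ (2 * ρ), gg ε (N + s * q) q v x) + A ρ)) +
      K * ∫⁻ x in Metric.ball x₀ (2 * ρ), ‖v x‖ₑ ^ q) +
        K * (volume (Metric.ball x₀ (2 * ρ)) * (2 + M)) with hR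
  have hvol := vol_ball_tendsto hN x₀ (c := 2) (by norm_num)
  have t1 : Tendsto (fun ρ => ∫⁻ x in Metric.ball x₀ (2 * ρ), ‖v x‖ₑ ^ q) (𝓝[>] (0 : ℝ)) (𝓝 0) :=
    tendsto_setLIntegral_zero hv1t hvol
  have t2 : Tendsto (fun ρ => ∫⁻ x in Metric.ball x₀ (2 * ρ), gg ε (N + s * q) q v x)
      (𝓝[>] (0 : ℝ)) (𝓝 0) := tendsto_setLIntegral_zero hv2t hvol
  have h2ρ : Tendsto (fun ρ : ℝ => 2 * ρ) (𝓝[>] (0 : ℝ)) (𝓝[>] (0 : ℝ)) := by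
    refine tendsto_nhdsWithin_iff.2 ⟨?_, ?_⟩
    · have : Tendsto (fun ρ : ℝ => 2 * ρ) (𝓝 0) (𝓝 (2 * 0)) := (continuous_const_mul 2).tendsto 0
      rw [mul_zero] at this
      exact this.mono_left nhdsWithin_le_nhds
    · filter_upwards [self_mem_nhdsWithin] with ρ hρ
      have : (0 : ℝ) < ρ := hρ
      show (0 : ℝ) < 2 * ρ
      linarith
  have tA : Tendsto A (𝓝[>] (0 : ℝ)) (𝓝 0) := by
    have := ENNReal.Tendsto.const_mul (a := cc)
      ((small_ball hN hq hb hsq hε hv hv1t hv2t x₀).comp h2ρ) (Or.inr hcct)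
    rw [mul_zero] at this
    exact this
  have cm : ∀ {f : ℝ → ℝ≥0∞} {c : ℝ≥0∞}, c ≠ ⊤ → Tendsto f (𝓝[>] (0 : ℝ)) (𝓝 0) →
      Tendsto (fun ρ => c * f ρ) (𝓝[>] (0 : ℝ)) (𝓝 0) := by
    intro f c hc hf
    have := ENNReal.Tendsto.const_mul (a := c) hf (Or.inr hc)
    rwa [mul_zero] at this
  have ca : ∀ {f g : ℝ → ℝ≥0∞}, Tendsto f (𝓝[>] (0 : ℝ)) (𝓝 0) →
      Tendsto g (𝓝[>] (0 : ℝ)) (𝓝 0) →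
      Tendsto (fun ρ => f ρ + g ρ) (𝓝[>] (0 : ℝ)) (𝓝 0) := by
    intro f g hf hg
    have := hf.add hg
    rwa [add_zero] at this
  have tR : Tendsto R (𝓝[>] (0 : ℝ)) (𝓝 0) := by
    refine ca (cm h2t (ca (ca tA (cm h2t (ca t2 tA))) (cm hKt t1))) (cm hKt ?_)
    have h2M : (2 + M) ≠ ⊤ := ENNReal.add_ne_top.2 ⟨by simp, hMt⟩
    simp only [mul_comm _ (2 + M)]
    exact cm h2M hvol
  have hle : ∀ᶠ ρ in 𝓝[>] (0 : ℝ), limsup (fun n => ∫⁻ x, ∫⁻ y,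
      FF s p (fun x => ψ (ρ⁻¹ • (x - x₀))) (vn n) x y) atTop ≤ R ρ := by
    filter_upwards [self_mem_nhdsWithin] with ρ hρ'
    have hρ : (0 : ℝ) < ρ := hρ'
    have hχm : Measurable fun x : Euc N => ψ (ρ⁻¹ • (x - x₀)) := by
      have := hψsm.continuous
      exact Continuous.measurable (by fun_prop)
    have hχ : ∀ x y : Euc N, |ψ (ρ⁻¹ • (x - x₀)) - ψ (ρ⁻¹ • (y - x₀))| ≤
        min 1 (2 * ‖ρ⁻¹ • (x - y)‖) := by
      intro x y
      refine le_min ?_ ?_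
      · rw [abs_le]
        constructor <;> linarith [hψ0 (ρ⁻¹ • (x - x₀)), hψ1 (ρ⁻¹ • (x - x₀)),
          hψ0 (ρ⁻¹ • (y - x₀)), hψ1 (ρ⁻¹ • (y - x₀))]
      · have := hlip.dist_le_mul (ρ⁻¹ • (x - x₀)) (ρ⁻¹ • (y - x₀))
        rw [Real.dist_eq, dist_eq_norm, ← smul_sub, sub_sub_sub_cancel_right] at this
        exact this
    have hχB : ∀ x, x ∉ Metric.ball x₀ (2 * ρ) → ψ (ρ⁻¹ • (x - x₀)) = 0 := by
      intro x hx
      by_contra h0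
      have := hψsupp (subset_tsupport ψ h0)
      rw [mem_ball_zero_iff, norm_smul, norm_inv, Real.norm_of_nonneg hρ.le] at this
      apply hx
      rw [Metric.mem_ball, dist_eq_norm]
      rwa [inv_mul_lt_iff₀ hρ, mul_comm] at this
    have hB : MeasurableSet (Metric.ball x₀ (2 * ρ)) := Metric.isOpen_ball.measurableSet
    refine (inner_limsup hN hs hs1 hq hε hρ hKt hK hvn hv hMt hM1 hM2 hv1 hv2 hconv hχm hχ hB
      measure_ball_lt_top.ne hχB).trans ?_
    have hAB : ∫⁻ x in Metric.ball x₀ (2 * ρ),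
        ‖v x‖ₑ ^ q * gg ε (N + s * q) q (fun x => ψ (ρ⁻¹ • (x - x₀))) x ≤ A ρ := by
      calc _ ≤ ∫⁻ x in Metric.ball x₀ (2 * ρ),
            ‖v x‖ₑ ^ q * (ENNReal.ofReal (ρ ^ (-(s * q))) * cK N q (s * q)) := by
            refine lintegral_mono fun x => ?_
            gcongr
            exact gg_cutoff hq0 hρ hχ x
        _ = A ρ := by
            rw [lintegral_mul_const _ (hv.enorm.pow_const q), hA, hcc]
            have e : ENNReal.ofReal (ρ ^ (-(s * q))) =
                ENNReal.ofReal (2 ^ (s * q)) * ENNReal.ofReal ((2 * ρ) ^ (-(s * q))) := by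
              rw [← ENNReal.ofReal_mul (by positivity), Real.mul_rpow (by norm_num) hρ.le,
                ← mul_assoc, ← Real.rpow_add (by norm_num)]
              simp
            rw [e]
            ring
    have hD := weight_D (ε := ε) (a := N + s * q) hq hχm
      (fun x y => (hχ x y).trans (min_le_left _ _)) hB hχB hv
    have hD2 := hD.trans (add_le_add hAB (mul_le_mul_right (add_le_add le_rfl hAB) _))
    simp only [hR]
    gcongr
  refine le_antisymm ?_ bot_le
  exact (limsup_le_limsup hle).trans tR.limsup_eq.le


lemma sobKernel_near {N : ℕ} {s q ε : ℝ} {p : Euc N → Euc N → ℝ} (hq : 0 < q) (u : Euc N → ℝ)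
    {x y : Euc N} (hxy : dist x y < ε) (hp : p x y = q) :
    sobKernel s p u x y = ‖u x - u y‖ₑ ^ q * kk ε (N + s * q) x y := by
  unfold sobKernel kk
  rw [if_pos hxy, hp, ← enorm_rpow_eq hq.le, ← ENNReal.ofReal_mul (by positivity), div_eq_mul_inv]

lemma mod_bounds {N : ℕ} {s q ε : ℝ} {p : Euc N → Euc N → ℝ} (hq : 0 < q) (hε : 0 < ε)
    (hdiag : ∀ x y, dist x y < ε → p x y = q) (u : Euc N → ℝ) :
    (∫⁻ x, ‖u x‖ₑ ^ q) ≤ sobModular Set.univ s p u ∧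
      (∫⁻ x, gg ε (N + s * q) q u x) ≤ sobModular Set.univ s p u := by
  unfold sobModular
  simp only [Measure.restrict_univ]
  constructor
  · refine le_trans (le_of_eq ?_) le_self_add
    congr 1; funext x
    rw [hdiag x x (by simpa using hε), enorm_rpow_eq hq.le]
  · refine le_trans ?_ le_add_self
    refine lintegral_mono fun x => lintegral_mono fun y => ?_
    by_cases h : dist x y < ε
    · exact (sobKernel_near hq u h (hdiag x y h)).ge
    · simp [kk, h]

lemma pow_div_le {t c r : ℝ} (ht : 0 ≤ t) (hc : 1 ≤ c) (hr : 1 ≤ r) :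
    (t / c) ^ r ≤ c⁻¹ * t ^ r := by
  have hc0 : 0 < c := by linarith
  rw [Real.div_rpow ht hc0.le, div_eq_inv_mul]
  gcongr
  calc c = c ^ (1 : ℝ) := (Real.rpow_one c).symm
    _ ≤ c ^ r := Real.rpow_le_rpow_of_exponent_le hc hr

lemma sob_set_nonempty {N : ℕ} {s : ℝ} {p : Euc N → Euc N → ℝ} (h1 : ∀ x y, 1 ≤ p x y)
    {u : Euc N → ℝ} (hu : sobModular Set.univ s p u < ⊤) :
    {c : ℝ | 0 < c ∧ sobModular Set.univ s p (fun x => u x / c) ≤ 1}.Nonempty := by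
  set m := (sobModular Set.univ s p u).toReal with hm
  set c := max 1 m with hc
  have hc1 : 1 ≤ c := le_max_left _ _
  have hc0 : 0 < c := by linarith
  refine ⟨c, hc0, ?_⟩
  have e : sobModular Set.univ s p (fun x => u x / c) ≤
      ENNReal.ofReal c⁻¹ * sobModular Set.univ s p u := by
    unfold sobModular
    simp only [Measure.restrict_univ]
    rw [mul_add, ← lintegral_const_mul' _ _ ENNReal.ofReal_ne_top,
      ← lintegral_const_mul' _ _ ENNReal.ofReal_ne_top]
    refine add_le_add (lintegral_mono fun x => ?_) (lintegral_mono fun x => ?_)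
    · rw [← ENNReal.ofReal_mul (by positivity), abs_div, abs_of_pos hc0]
      exact ENNReal.ofReal_le_ofReal (pow_div_le (abs_nonneg _) hc1 (h1 x x))
    · rw [← lintegral_const_mul' _ _ ENNReal.ofReal_ne_top]
      refine lintegral_mono fun y => ?_
      unfold sobKernel
      rw [← ENNReal.ofReal_mul (by positivity), ← sub_div, abs_div, abs_of_pos hc0]
      refine ENNReal.ofReal_le_ofReal ?_
      rw [← mul_div_assoc]
      gcongr
      exact pow_div_le (abs_nonneg _) hc1 (h1 x y)
  refine e.trans ?_
  rw [← ENNReal.ofReal_toReal hu.ne, ← ENNReal.ofReal_mul (by positivity), ← ENNReal.ofReal_one]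
  refine ENNReal.ofReal_le_ofReal ?_
  rw [← hm, inv_mul_le_iff₀ hc0, mul_one]
  exact le_max_right _ _

lemma norm_bounds {N : ℕ} {s q ε C : ℝ} {p : Euc N → Euc N → ℝ} (hq : 1 < q) (hε : 0 < ε)
    (hdiag : ∀ x y, dist x y < ε → p x y = q) (h1 : ∀ x y, 1 ≤ p x y)
    {u : Euc N → ℝ} (hu : sobModular Set.univ s p u < ⊤) (hC : sobNorm Set.univ s p u ≤ C) :
    (∫⁻ x, ‖u x‖ₑ ^ q) ≤ ENNReal.ofReal (C + 1) ^ q ∧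
      (∫⁻ x, gg ε (N + s * q) q u x) ≤ ENNReal.ofReal (C + 1) ^ q := by
  have hq0 : 0 < q := by linarith
  have hlt : sInf {c : ℝ | 0 < c ∧ sobModular Set.univ s p (fun x => u x / c) ≤ 1} < C + 1 := by
    have : sobNorm Set.univ s p u < C + 1 := by linarith
    exact this
  obtain ⟨c, ⟨hc0, hc1⟩, hc2⟩ := exists_lt_of_csInf_lt (sob_set_nonempty h1 hu) hlt
  obtain ⟨b1, b2⟩ := mod_bounds (s := s) hq0 hε hdiag (fun x => u x / c)
  have hcC : ‖c‖ₑ ^ q ≤ ENNReal.ofReal (C + 1) ^ q := by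
    gcongr
    rw [← ofReal_norm, Real.norm_of_nonneg hc0.le]
    exact ENNReal.ofReal_le_ofReal hc2.le
  have hct : ‖c‖ₑ ^ q ≠ ⊤ := ENNReal.rpow_ne_top_of_nonneg hq0.le enorm_ne_top
  have es : ∀ t : ℝ, ‖t‖ₑ ^ q = ‖c‖ₑ ^ q * ‖t / c‖ₑ ^ q := by
    intro t
    rw [← ENNReal.mul_rpow_of_nonneg _ _ hq0.le, ← enorm_mul, mul_div_cancel₀ _ hc0.ne']
  constructor
  · calc ∫⁻ x, ‖u x‖ₑ ^ q = ‖c‖ₑ ^ q * ∫⁻ x, ‖u x / c‖ₑ ^ q := by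
          rw [← lintegral_const_mul' _ _ hct]
          simp only [← es]
      _ ≤ ‖c‖ₑ ^ q * 1 := by gcongr; exact b1.trans hc1
      _ ≤ _ := by rwa [mul_one]
  · have e2 : ∀ x, gg ε (N + s * q) q u x =
        ‖c‖ₑ ^ q * gg ε (N + s * q) q (fun x => u x / c) x := by
      intro x
      unfold gg
      rw [← lintegral_const_mul' _ _ hct]
      congr 1; funext y
      rw [← mul_assoc, ← sub_div, ← es]
    calc ∫⁻ x, gg ε (N + s * q) q u x =
          ‖c‖ₑ ^ q * ∫⁻ x, gg ε (N + s * q) q (fun x => u x / c) x := by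
          rw [← lintegral_const_mul' _ _ hct]
          simp only [← e2]
      _ ≤ ‖c‖ₑ ^ q * 1 := by gcongr; exact b2.trans hc1
      _ ≤ _ := by rwa [mul_one]

lemma sob_integrableOn {N : ℕ} {s q ε : ℝ} {p : Euc N → Euc N → ℝ} (hq : 1 < q) (hε : 0 < ε)
    (hdiag : ∀ x y, dist x y < ε → p x y = q) {f : Euc N → ℝ} (hf : MemSob Set.univ s p f)
    (x : Euc N) (h : ℝ) : IntegrableOn f (Metric.ball x h) := by
  have hm := hf.1
  rw [Measure.restrict_univ] at hm
  exact integrableOn_of_Lq hq hm (ne_top_of_le_ne_top hf.2.ne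
    (mod_bounds (s := s) (by linarith) hε hdiag f).1) x h

lemma ball_func {N : ℕ} {s q ε : ℝ} {p : Euc N → Euc N → ℝ} (hq : 1 < q) (hε : 0 < ε)
    (hdiag : ∀ x y, dist x y < ε → p x y = q) (h1 : ∀ x y, 1 ≤ p x y) (x : Euc N) (h : ℝ) :
    IsBddLinFunc s p (fun f => ∫ y in Metric.ball x h, f y) := by
  have hq0 : 0 < q := by linarith
  refine ⟨fun f g hf hg => ?_, fun c f hf => ?_, ?_⟩
  · exact integral_add (sob_integrableOn hq hε hdiag hf x h) (sob_integrableOn hq hε hdiag hg x h)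
  · exact integral_const_mul c f
  · set V : ℝ≥0∞ := volume (Metric.ball x h) + 1 with hV
    have hVt : V ≠ ⊤ := ENNReal.add_ne_top.2 ⟨measure_ball_lt_top.ne, by simp⟩
    have hV0 : 0 < V.toReal := ENNReal.toReal_pos (by simp [hV]) hVt
    refine ⟨V.toReal, fun f hf => ?_⟩
    rw [mul_comm, ← div_le_iff₀ hV0]
    refine le_csInf (sob_set_nonempty h1 hf.2) ?_
    rintro c ⟨hc0, hc1⟩
    rw [div_le_iff₀ hV0]
    have e : ∫ y in Metric.ball x h, f y = c * ∫ y in Metric.ball x h, f y / c := by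
      rw [← integral_const_mul]
      congr 1; funext y
      field_simp
    have b : ‖∫ y in Metric.ball x h, f y / c‖ₑ ≤ V := by
      calc _ ≤ ∫⁻ y in Metric.ball x h, ‖f y / c‖ₑ := enorm_integral_le_lintegral_enorm _
        _ ≤ ∫⁻ y in Metric.ball x h, (1 + ‖f y / c‖ₑ ^ q) := by
            refine lintegral_mono fun y => ?_
            rw [← enorm_rpow_eq hq0.le, ← ENNReal.ofReal_one, ← ENNReal.ofReal_add (by norm_num)
              (by positivity), ← ofReal_norm, Real.norm_eq_abs]
            refine ENNReal.ofReal_le_ofReal ?_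
            have := rpow_le_one_add (abs_nonneg (f y / c)) one_pos hq.le
            rwa [Real.rpow_one] at this
        _ = volume (Metric.ball x h) + ∫⁻ y in Metric.ball x h, ‖f y / c‖ₑ ^ q := by
            rw [lintegral_add_left measurable_const]
            simp
        _ ≤ V := by
            rw [hV]
            gcongr
            exact (setLIntegral_le_lintegral _ _).trans
              ((mod_bounds (s := s) hq0 hε hdiag (fun x => f x / c)).1.trans hc1)
    have b2 : |∫ y in Metric.ball x h, f y / c| ≤ V.toReal := by
      have := ENNReal.toReal_mono hVt b
      rwa [toReal_enorm, Real.norm_eq_abs] at this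
    simp only [e]
    rw [abs_mul, abs_of_pos hc0]
    gcongr

lemma gg_congr {N : ℕ} {ε a q : ℝ} {u v : Euc N → ℝ} (h : u =ᵐ[volume] v) :
    ∫⁻ x, gg ε a q u x = ∫⁻ x, gg ε a q v x := by
  refine lintegral_congr_ae ?_
  filter_upwards [h] with x hx
  unfold gg
  refine lintegral_congr_ae ?_
  filter_upwards [h] with y hy
  rw [hx, hy]

lemma pow_congr {N : ℕ} {q : ℝ} {u v : Euc N → ℝ} (h : u =ᵐ[volume] v) :
    ∫⁻ x, ‖u x‖ₑ ^ q = ∫⁻ x, ‖v x‖ₑ ^ q := by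
  refine lintegral_congr_ae ?_
  filter_upwards [h] with x hx
  rw [hx]


/-- Lemma 4.4: vanishing of the localized energies as ρ → 0⁺. -/
theorem aux_lemma_small_balls {N : ℕ}
    (s pminus pbar ε₀ : ℝ) (hs : s ∈ Set.Ioo (0 : ℝ) 1)
    (p : Euc N → Euc N → ℝ) (pstar : Euc N → ℝ)
    (hpuc : UniformContinuous fun z : Euc N × Euc N => p z.1 z.2)
    (hpsym : ∀ x y, p x y = p y x)
    (hpminus : IsGLB (Set.range fun z : Euc N × Euc N => p z.1 z.2) pminus)
    (hpbar : IsLUB (Set.range fun z : Euc N × Euc N => p z.1 z.2) pbar)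
    (hpm1 : 1 < pminus) (hpbarN : pbar < (N : ℝ) / s)
    (hε₀ : ε₀ ∈ Set.Ioo (0 : ℝ) (1 / 2))
    (hdiag : ∀ x y : Euc N, dist x y < ε₀ → p x y = pbar)
    (hsupx : ∀ x : Euc N, IsLUB (Set.range (p x)) pbar)
    (hpstar : ∀ x : Euc N, IsGLB (Set.range (p x)) (pstar x))
    (hfin : volume {x : Euc N | pstar x ≠ pbar} < ⊤)
    (x₀ : Euc N) (ψ : Euc N → ℝ)
    (hψsm : ContDiff ℝ (⊤ : ℕ∞) ψ) (hψ0 : ∀ x, 0 ≤ ψ x) (hψ1 : ∀ x, ψ x ≤ 1)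
    (hψone : ∀ x ∈ Metric.ball (0 : Euc N) 1, ψ x = 1)
    (hψsupp : tsupport ψ ⊆ Metric.ball (0 : Euc N) 2)
    (hψgrad : ∀ x, ‖fderiv ℝ ψ x‖ ≤ 2)
    (un : ℕ → Euc N → ℝ) (u : Euc N → ℝ)
    (hmem : ∀ n, MemSob Set.univ s p (un n)) (humem : MemSob Set.univ s p u)
    (hbdd : ∃ C : ℝ, ∀ n, sobNorm Set.univ s p (un n) ≤ C)
    (hweak : WeakConvSob s p un u) :
    limsup (fun ρ : ℝ => limsup
        (fun n => ∫⁻ x, ∫⁻ y, ENNReal.ofReal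
          (|un n x| ^ p x y *
            |ψ (ρ⁻¹ • (x - x₀)) - ψ (ρ⁻¹ • (y - x₀))| ^ p x y /
              dist x y ^ ((N : ℝ) + s * p x y))) atTop)
      (𝓝[>] (0 : ℝ)) = 0 := by
  have hp1 : ∀ x y, pminus ≤ p x y := fun x y => hpminus.1 ⟨(x, y), rfl⟩
  have hp2 : ∀ x y, p x y ≤ pbar := fun x y => hpbar.1 ⟨(x, y), rfl⟩
  have hq : 1 < pbar := by linarith [hp1 0 0, hp2 0 0]
  have hsq : s * pbar < N := by
    have := (lt_div_iff₀ hs.1).1 hpbarN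
    linarith [mul_comm s pbar]
  have hN : 0 < N := by
    have h0 : 0 < s * pbar := mul_pos hs.1 (by linarith)
    have : (0 : ℝ) < N := by linarith
    exact_mod_cast this
  have h11 : ∀ x y, 1 ≤ p x y := fun x y => hpm1.le.trans (hp1 x y)
  obtain ⟨C, hC⟩ := hbdd
  have hm : ∀ n, AEStronglyMeasurable (un n) volume := fun n => by
    have := (hmem n).1
    rwa [Measure.restrict_univ] at this
  have hmu : AEStronglyMeasurable u volume := by
    have := humem.1
    rwa [Measure.restrict_univ] at this
  set vn : ℕ → Euc N → ℝ := fun n => (hm n).mk (un n) with hvn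
  set v : Euc N → ℝ := hmu.mk u with hv
  have evn : ∀ n, un n =ᵐ[volume] vn n := fun n => (hm n).ae_eq_mk
  have ev : u =ᵐ[volume] v := hmu.ae_eq_mk
  have hnb := fun n => norm_bounds hq hε₀.1 hdiag h11 (hmem n).2 (hC n)
  have hub := mod_bounds (s := s) (by linarith : 0 < pbar) hε₀.1 hdiag u
  set M := ENNReal.ofReal (C + 1) ^ pbar + sobModular Set.univ s p u with hM
  have hMt : M ≠ ⊤ := ENNReal.add_ne_top.2
    ⟨ENNReal.rpow_ne_top_of_nonneg (by linarith) ENNReal.ofReal_ne_top, humem.2.ne⟩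
  have hfinal := core (vn := vn) (v := v) (M := M) hN hs.1 hs.2 hpm1 hp1 hp2 hsq hε₀.1 hε₀.2 hdiag
    (fun n => (hm n).stronglyMeasurable_mk.measurable) hmu.stronglyMeasurable_mk.measurable hMt
    (fun n => (pow_congr (evn n)).symm.le.trans ((hnb n).1.trans le_self_add))
    (fun n => (gg_congr (evn n)).symm.le.trans ((hnb n).2.trans le_self_add))
    ((pow_congr ev).symm.le.trans (hub.1.trans le_add_self))
    ((gg_congr ev).symm.le.trans (hub.2.trans le_add_self))
    (fun x h _ => by
      have := hweak _ (ball_func (s := s) hq hε₀.1 hdiag h11 x h)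
      have e1 : ∀ n, ∫ y in Metric.ball x h, un n y = ∫ y in Metric.ball x h, vn n y :=
        fun n => integral_congr_ae (ae_restrict_of_ae (evn n))
      have e2 : ∫ y in Metric.ball x h, u y = ∫ y in Metric.ball x h, v y :=
        integral_congr_ae (ae_restrict_of_ae ev)
      simp only [e1, e2] at this
      exact this)
    x₀ ψ hψsm hψ0 hψ1 hψsupp hψgrad
  rw [← hfinal]
  congr 1; funext ρ
  congr 1; funext n
  refine lintegral_congr_ae ?_
  filter_upwards [evn n] with x hx
  unfold FF
  rw [hx]
end
end

section
/- Assume (P₂). Let φ ∈ C^∞(ℝ^N) satisfy 0 ≤ φ ≤ 1, φ ≡ 0 on B₁(0), φ ≡ 1 on ℝ^N∖B₂(0) and ‖∇φ‖_∞ ≤ 2; for R > 0 set φ_R(x) := φ(x/R). Let {u_n} be a bounded sequence in W^{s,p(·,·)}(ℝ^N) converging weakly to some u. Then lim_{R→∞} limsup_{n→∞} ∫_{ℝ^N}∫_{ℝ^N} |u_n(x)|^{p(x,y)} · |φ_R(x)−φ_R(y)|^{p(x,y)}/|x−y|^{N+s·p(x,y)} dy dx = 0. -/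
open MeasureTheory Filter Topology Set
open scoped ENNReal NNReal

noncomputable section

def auxK (N : ℕ) (s a R r : ℝ) : ℝ := (min 1 (2 * r / R) / r ^ s) ^ a / r ^ (N : ℝ)

lemma auxK_nonneg (N : ℕ) (s a R r : ℝ) (hR : 0 < R) (hr : 0 ≤ r) : 0 ≤ auxK N s a R r := by
  unfold auxK; positivity

lemma auxK_mono (N : ℕ) (s a R r : ℝ) (ha : 0 ≤ a) (hR : 1 ≤ R) (hr : 0 ≤ r) :
    auxK N s a R r ≤ auxK N s a 1 r := by
  unfold auxK
  have : 2 * r / R ≤ 2 * r / 1 := by gcongr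
  have h0 : 0 ≤ 2 * r / R := by positivity
  gcongr

lemma auxK_meas (N : ℕ) (s a R : ℝ) : Measurable (auxK N s a R) := by
  unfold auxK; fun_prop

lemma auxK_tendsto (N : ℕ) (s a r : ℝ) (ha : 0 < a) :
    Tendsto (fun R => auxK N s a R r) atTop (𝓝 0) := by
  unfold auxK
  have h1 : Tendsto (fun R : ℝ => 2 * r / R) atTop (𝓝 0) := tendsto_const_nhds.div_atTop tendsto_id
  have h2 : Tendsto (fun R : ℝ => min 1 (2 * r / R)) atTop (𝓝 (min 1 0)) := tendsto_const_nhds.min h1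
  have h3 := ((h2.div_const (r ^ s)).rpow_const (p := a) (Or.inr ha.le)).div_const (r ^ (N : ℝ))
  have : (min (1:ℝ) 0 / r ^ s) ^ a / r ^ (N : ℝ) = 0 := by simp [Real.zero_rpow ha.ne']
  rwa [this] at h3

lemma auxK_integrable (N : ℕ) (hN : 0 < N) (s a : ℝ) (hs : s ∈ Set.Ioo (0 : ℝ) 1) (ha : 0 < a) :
    Integrable (fun x : Euc N => auxK N s a 1 ‖x‖) := by
  obtain ⟨hs0, hs1⟩ := hs
  haveI : Nonempty (Fin N) := ⟨⟨0, hN⟩⟩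
  rw [integrable_fun_norm_addHaar (volume : Measure (Euc N)) (f := auxK N s a 1)]
  rw [finrank_euclideanSpace_fin]
  have hmeas : AEStronglyMeasurable (fun y : ℝ => y ^ (N - 1) • auxK N s a 1 y) volume :=
    ((measurable_id.pow_const (N - 1)).smul (auxK_meas N s a 1)).aestronglyMeasurable
  have key : ∀ y : ℝ, 0 < y → y ^ (N - 1) • auxK N s a 1 y
      = (min 1 (2 * y)) ^ a * y ^ (-(s * a) - 1) := by
    intro y hy
    have h1 : (y ^ (N - 1) : ℝ) = y ^ ((N : ℝ) - 1) := by
      rw [← Real.rpow_natCast, Nat.cast_sub hN]; simp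
    unfold auxK
    rw [smul_eq_mul, h1, div_one, Real.div_rpow (by positivity) (by positivity), ← Real.rpow_mul hy.le]
    rw [div_div, ← Real.rpow_add hy, mul_div_left_comm, ← Real.rpow_sub hy]
    congr 2; ring
  rw [← Ioc_union_Ioi_eq_Ioi (zero_le_one' ℝ)]
  refine IntegrableOn.union ?_ ?_
  · have hi : IntegrableOn (fun y : ℝ => 2 ^ a * y ^ (a * (1 - s) - 1)) (Ioc 0 1) := by
      have := (intervalIntegral.intervalIntegrable_rpow' (a := 0) (b := 1)
        (r := a * (1 - s) - 1) (by nlinarith [mul_pos ha (sub_pos.2 hs1)]))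
      rw [intervalIntegrable_iff_integrableOn_Ioc_of_le zero_le_one] at this
      exact this.const_mul _
    refine Integrable.mono' hi hmeas.restrict ?_
    refine (ae_restrict_iff' measurableSet_Ioc).2 (Eventually.of_forall fun y hy => ?_)
    have hy0 := hy.1
    rw [key y hy.1, Real.norm_of_nonneg (by positivity)]
    calc (min 1 (2 * y)) ^ a * y ^ (-(s * a) - 1) ≤ (2 * y) ^ a * y ^ (-(s * a) - 1) := by
          gcongr; exact min_le_right _ _
      _ = _ := by
          rw [Real.mul_rpow (by norm_num) hy0.le, mul_assoc, ← Real.rpow_add hy0]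
          congr 2; ring
  · have hi : IntegrableOn (fun y : ℝ => y ^ (-(s * a) - 1)) (Ioi 1) :=
      integrableOn_Ioi_rpow_of_lt (by nlinarith [mul_pos hs0 ha]) one_pos
    refine Integrable.mono' hi hmeas.restrict ?_
    refine (ae_restrict_iff' measurableSet_Ioi).2 (Eventually.of_forall fun y hy => ?_)
    have hy0 : 0 < y := lt_trans one_pos hy
    rw [key y hy0, Real.norm_of_nonneg (by positivity)]
    refine mul_le_of_le_one_left (by positivity) ?_
    exact Real.rpow_le_one (by positivity) (min_le_left _ _) ha.le

lemma auxK_lint_ne_top (N : ℕ) (hN : 0 < N) (s a R : ℝ) (hs : s ∈ Set.Ioo (0 : ℝ) 1) (ha : 0 < a)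
    (hR : 1 ≤ R) :
    ∫⁻ x : Euc N, ENNReal.ofReal (auxK N s a R ‖x‖) ≠ ⊤ := by
  refine ne_top_of_le_ne_top (auxK_integrable N hN s a hs ha).lintegral_lt_top.ne ?_
  exact lintegral_mono fun x => ENNReal.ofReal_le_ofReal (auxK_mono N s a R _ ha.le hR (norm_nonneg _))

lemma auxK_lint_tendsto (N : ℕ) (hN : 0 < N) (s a : ℝ) (hs : s ∈ Set.Ioo (0 : ℝ) 1) (ha : 0 < a) :
    Tendsto (fun R => ∫⁻ x : Euc N, ENNReal.ofReal (auxK N s a R ‖x‖)) atTop (𝓝 0) := by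
  have := tendsto_lintegral_filter_of_dominated_convergence (μ := (volume : Measure (Euc N)))
    (l := atTop) (F := fun R x => ENNReal.ofReal (auxK N s a R ‖x‖)) (f := fun _ => 0)
    (fun x => ENNReal.ofReal (auxK N s a 1 ‖x‖))
    (Eventually.of_forall fun R => ((auxK_meas N s a R).comp measurable_norm).ennreal_ofReal)
    ((eventually_ge_atTop 1).mono fun R hR => Eventually.of_forall fun x =>
      ENNReal.ofReal_le_ofReal (auxK_mono N s a R _ ha.le hR (norm_nonneg _)))
    (auxK_integrable N hN s a hs ha).lintegral_lt_top.ne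
    (Eventually.of_forall fun x => by
      simpa using ENNReal.tendsto_ofReal (auxK_tendsto N s a ‖x‖ ha))
  simpa using this

lemma rpow_le_add (q a b t : ℝ) (hq : 0 ≤ q) (ha : 0 < a) (h1 : a ≤ t) (h2 : t ≤ b) :
    q ^ t ≤ q ^ a + q ^ b := by
  have := Real.rpow_nonneg hq a
  have := Real.rpow_nonneg hq b
  rcases hq.eq_or_lt with rfl | hq0
  · rw [Real.zero_rpow (by linarith)]; positivity
  rcases le_total q 1 with h | h
  · have := Real.rpow_le_rpow_of_exponent_ge hq0 h h1; linarith
  · have := Real.rpow_le_rpow_of_exponent_le h h2; linarith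

lemma kernel_bound (N : ℕ) (s a b t R d δ : ℝ) (hR : 0 < R) (ha : 0 < a)
    (h1 : a ≤ t) (h2 : t ≤ b) (hd : 0 ≤ d) (hδ : 0 ≤ δ) (hδ1 : δ ≤ 1) (hδ2 : δ ≤ 2 * d / R) :
    δ ^ t / d ^ ((N : ℝ) + s * t) ≤ auxK N s a R d + auxK N s b R d := by
  have ht : 0 < t := by linarith
  rcases hd.eq_or_lt with rfl | hd0
  · have : δ = 0 := le_antisymm (by simpa using hδ2) hδ
    rw [this, Real.zero_rpow ht.ne', zero_div]
    exact add_nonneg (auxK_nonneg _ _ _ _ _ hR le_rfl) (auxK_nonneg _ _ _ _ _ hR le_rfl)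
  · have hm : δ ≤ min 1 (2 * d / R) := le_min hδ1 hδ2
    calc δ ^ t / d ^ ((N : ℝ) + s * t) ≤ (min 1 (2 * d / R)) ^ t / d ^ ((N : ℝ) + s * t) := by gcongr
      _ = (min 1 (2 * d / R) / d ^ s) ^ t / d ^ (N : ℝ) := by
          rw [Real.div_rpow (by positivity) (by positivity), ← Real.rpow_mul hd0.le, div_div,
            ← Real.rpow_add hd0, add_comm]
      _ ≤ _ := by
          unfold auxK
          rw [← add_div]
          gcongr
          exact rpow_le_add _ _ _ _ (by positivity) ha h1 h2

lemma sobModular_div (N : ℕ) (s : ℝ) (p : Euc N → Euc N → ℝ) (hp : ∀ x y, 1 ≤ p x y)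
    (u : Euc N → ℝ) (c : ℝ) (hc : 1 ≤ c) :
    sobModular Set.univ s p (fun x => u x / c) ≤ ENNReal.ofReal c⁻¹ * sobModular Set.univ s p u := by
  have hc0 : 0 < c := by linarith
  have key : ∀ v t : ℝ, 1 ≤ t → |v / c| ^ t ≤ c⁻¹ * |v| ^ t := by
    intro v t ht
    rw [div_eq_inv_mul, abs_mul, abs_of_pos (inv_pos.2 hc0),
      Real.mul_rpow (by positivity) (by positivity)]
    gcongr
    simpa using Real.rpow_le_rpow_of_exponent_ge (inv_pos.2 hc0) (inv_le_one_of_one_le₀ hc) ht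
  unfold sobModular
  rw [mul_add, ← lintegral_const_mul' _ _ ENNReal.ofReal_ne_top,
    ← lintegral_const_mul' _ _ ENNReal.ofReal_ne_top]
  refine add_le_add (lintegral_mono fun x => ?_) (lintegral_mono fun x => ?_)
  · rw [← ENNReal.ofReal_mul (by positivity)]
    exact ENNReal.ofReal_le_ofReal (key _ _ (hp _ _))
  · dsimp only
    rw [← lintegral_const_mul' _ _ ENNReal.ofReal_ne_top]
    refine lintegral_mono fun y => ?_
    unfold sobKernel
    rw [← ENNReal.ofReal_mul (by positivity)]
    refine ENNReal.ofReal_le_ofReal ?_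
    rw [← sub_div, ← mul_div_assoc]
    gcongr
    exact key _ _ (hp _ _)

lemma sob_bound (N : ℕ) (s q C : ℝ) (p : Euc N → Euc N → ℝ) (hp : ∀ x y, 1 ≤ p x y)
    (hq : ∀ x, p x x = q) (hq0 : 0 ≤ q)
    (u : Euc N → ℝ) (hu : MemSob Set.univ s p u) (hC : sobNorm Set.univ s p u ≤ C) :
    ∫⁻ x, ENNReal.ofReal (|u x| ^ q) ≤ ENNReal.ofReal ((C + 1) ^ q) := by
  have hne : {c : ℝ | 0 < c ∧ sobModular Set.univ s p (fun x => u x / c) ≤ 1}.Nonempty := by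
    set M := sobModular Set.univ s p u with hM
    have hMt : M ≠ ⊤ := hu.2.ne
    have hpos : 0 < M.toReal + 1 := by positivity
    refine ⟨M.toReal + 1, hpos, ?_⟩
    refine (sobModular_div N s p hp u _ (by simp)).trans ?_
    rw [← hM, ← ENNReal.ofReal_toReal hMt, ← ENNReal.ofReal_mul (by positivity),
      ENNReal.toReal_ofReal (by positivity), ← ENNReal.ofReal_one]
    refine ENNReal.ofReal_le_ofReal ?_
    rw [inv_mul_le_iff₀ hpos]; linarith
  obtain ⟨c, ⟨hc0, hc1⟩, hc2⟩ := exists_lt_of_csInf_lt hne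
    (show sobNorm Set.univ s p u < C + 1 by linarith)
  have h1 : ∫⁻ x, ENNReal.ofReal (|u x / c| ^ q) ≤ 1 := by
    refine le_trans ?_ hc1
    unfold sobModular
    refine le_trans ?_ le_self_add
    simp only [hq, Measure.restrict_univ, le_refl]
  have h2 : ∀ x, ENNReal.ofReal (|u x| ^ q)
      = ENNReal.ofReal (c ^ q) * ENNReal.ofReal (|u x / c| ^ q) := by
    intro x
    rw [← ENNReal.ofReal_mul (by positivity), ← Real.mul_rpow hc0.le (abs_nonneg _),
      abs_div, abs_of_pos hc0, mul_div_cancel₀ _ hc0.ne']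
  simp_rw [h2]
  rw [lintegral_const_mul' _ _ ENNReal.ofReal_ne_top]
  calc _ ≤ ENNReal.ofReal (c ^ q) * 1 := by gcongr
    _ ≤ _ := by rw [mul_one]; exact ENNReal.ofReal_le_ofReal (by gcongr)

/-- Lemma 4.5: vanishing of the energies localized near infinity
as R → ∞. -/
theorem aux_lemma_large_balls {N : ℕ}
    (s pminus pbar ε₀ : ℝ) (hs : s ∈ Set.Ioo (0 : ℝ) 1)
    (p : Euc N → Euc N → ℝ) (pstar : Euc N → ℝ)
    (hpuc : UniformContinuous fun z : Euc N × Euc N => p z.1 z.2)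
    (hpsym : ∀ x y, p x y = p y x)
    (hpminus : IsGLB (Set.range fun z : Euc N × Euc N => p z.1 z.2) pminus)
    (hpbar : IsLUB (Set.range fun z : Euc N × Euc N => p z.1 z.2) pbar)
    (hpm1 : 1 < pminus) (hpbarN : pbar < (N : ℝ) / s)
    (hε₀ : ε₀ ∈ Set.Ioo (0 : ℝ) (1 / 2))
    (hdiag : ∀ x y : Euc N, dist x y < ε₀ → p x y = pbar)
    (hsupx : ∀ x : Euc N, IsLUB (Set.range (p x)) pbar)
    (hpstar : ∀ x : Euc N, IsGLB (Set.range (p x)) (pstar x))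
    (hfin : volume {x : Euc N | pstar x ≠ pbar} < ⊤)
    (φ : Euc N → ℝ)
    (hφsm : ContDiff ℝ (⊤ : ℕ∞) φ) (hφ0 : ∀ x, 0 ≤ φ x) (hφ1 : ∀ x, φ x ≤ 1)
    (hφzero : ∀ x ∈ Metric.ball (0 : Euc N) 1, φ x = 0)
    (hφone : ∀ (x : Euc N), x ∉ Metric.ball (0 : Euc N) 2 → φ x = 1)
    (hφgrad : ∀ x, ‖fderiv ℝ φ x‖ ≤ 2)
    (un : ℕ → Euc N → ℝ) (u : Euc N → ℝ)
    (hmem : ∀ n, MemSob Set.univ s p (un n)) (humem : MemSob Set.univ s p u)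
    (hbdd : ∃ C : ℝ, ∀ n, sobNorm Set.univ s p (un n) ≤ C)
    (hweak : WeakConvSob s p un u) :
    Tendsto (fun R : ℝ => limsup
        (fun n => ∫⁻ x, ∫⁻ y, ENNReal.ofReal
          (|un n x| ^ p x y *
            |φ (R⁻¹ • x) - φ (R⁻¹ • y)| ^ p x y /
              dist x y ^ ((N : ℝ) + s * p x y))) atTop)
      atTop (𝓝 (0 : ℝ≥0∞)) := by
  obtain ⟨C, hC⟩ := hbdd
  have hlow : ∀ x y, pminus ≤ p x y := fun x y => hpminus.1 ⟨(x, y), rfl⟩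
  have hup : ∀ x y, p x y ≤ pbar := fun x y => hpbar.1 ⟨(x, y), rfl⟩
  have hxx : ∀ x, p x x = pbar := fun x => hdiag x x (by simpa using hε₀.1)
  have hmb : pminus ≤ pbar := (hlow 0 0).trans (hup 0 0)
  have hpm0 : 0 < pminus := by linarith
  have hpb0 : 0 < pbar := by linarith
  have hN : 0 < N := by
    rcases Nat.eq_zero_or_pos N with h | h
    · subst h; simp at hpbarN; linarith
    · exact h
  set A := {x : Euc N | pstar x ≠ pbar} with hA
  have hlip : ∀ x y, |φ x - φ y| ≤ 2 * dist x y := by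
    intro x y
    have := Convex.norm_image_sub_le_of_norm_fderiv_le (𝕜 := ℝ) (f := φ) (s := Set.univ) (C := 2)
      (fun x _ => (hφsm.differentiable (by simp)) x) (fun x _ => hφgrad x) convex_univ
      (Set.mem_univ y) (Set.mem_univ x)
    rwa [Real.norm_eq_abs, ← dist_eq_norm] at this
  set W : ℝ≥0∞ := volume A + ENNReal.ofReal ((C + 1) ^ pbar) with hW
  have hWt : W ≠ ⊤ := ENNReal.add_ne_top.2 ⟨hfin.ne, ENNReal.ofReal_ne_top⟩
  set K : ℝ → ℝ≥0∞ := fun R => (∫⁻ x : Euc N, ENNReal.ofReal (auxK N s pminus R ‖x‖)) +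
    ∫⁻ x : Euc N, ENNReal.ofReal (auxK N s pbar R ‖x‖) with hK
  have hK0 : Tendsto K atTop (𝓝 0) := by
    simpa using (auxK_lint_tendsto N hN s pminus hs hpm0).add (auxK_lint_tendsto N hN s pbar hs hpb0)
  have hWK : Tendsto (fun R => W * K R) atTop (𝓝 0) := by
    simpa using ENNReal.Tendsto.const_mul hK0 (Or.inr hWt)
  refine tendsto_of_tendsto_of_tendsto_of_le_of_le' tendsto_const_nhds hWK
    (Eventually.of_forall fun _ => bot_le) ?_
  filter_upwards [eventually_ge_atTop 1] with R hR
  have hR0 : 0 < R := by linarith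
  have hKt : K R ≠ ⊤ := ENNReal.add_ne_top.2
    ⟨auxK_lint_ne_top N hN s pminus R hs hpm0 hR, auxK_lint_ne_top N hN s pbar R hs hpb0 hR⟩
  refine limsup_le_of_le (by isBoundedDefault) (Eventually.of_forall fun n => ?_)
  have hub : ∀ x y, ENNReal.ofReal (|un n x| ^ p x y)
      ≤ A.indicator 1 x + ENNReal.ofReal (|un n x| ^ pbar) := by
    intro x y
    by_cases hx : x ∈ A
    · rw [Set.indicator_of_mem hx, Pi.one_apply, ← ENNReal.ofReal_one,
        ← ENNReal.ofReal_add zero_le_one (by positivity)]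
      refine ENNReal.ofReal_le_ofReal ?_
      have hpxy := hlow x y
      rcases le_total |un n x| 1 with h | h
      · have := Real.rpow_le_one (abs_nonneg (un n x)) h (by linarith : 0 ≤ p x y)
        have : 0 ≤ |un n x| ^ pbar := by positivity
        linarith
      · have := Real.rpow_le_rpow_of_exponent_le h (hup x y)
        linarith
    · have hx' : pstar x = pbar := by simpa [hA] using hx
      have : p x y = pbar := le_antisymm (hup x y) (hx' ▸ (hpstar x).1 ⟨y, rfl⟩)
      rw [this]; exact le_add_self
  have hkb : ∀ x y, ENNReal.ofReal (|un n x| ^ p x y *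
            |φ (R⁻¹ • x) - φ (R⁻¹ • y)| ^ p x y / dist x y ^ ((N : ℝ) + s * p x y))
      ≤ (A.indicator 1 x + ENNReal.ofReal (|un n x| ^ pbar)) *
        (ENNReal.ofReal (auxK N s pminus R ‖x - y‖) + ENNReal.ofReal (auxK N s pbar R ‖x - y‖)) := by
    intro x y
    rw [mul_div_assoc, ENNReal.ofReal_mul (by positivity),
      ← ENNReal.ofReal_add (auxK_nonneg _ _ _ _ _ hR0 (norm_nonneg _))
        (auxK_nonneg _ _ _ _ _ hR0 (norm_nonneg _))]
    refine mul_le_mul' (hub x y) (ENNReal.ofReal_le_ofReal ?_)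
    rw [← dist_eq_norm]
    refine kernel_bound N s pminus pbar (p x y) R (dist x y) _ hR0 hpm0 (hlow x y) (hup x y)
      dist_nonneg (abs_nonneg _) ?_ ?_
    · rw [abs_le]; constructor <;>
        linarith [hφ0 (R⁻¹ • x), hφ0 (R⁻¹ • y), hφ1 (R⁻¹ • x), hφ1 (R⁻¹ • y)]
    · refine (hlip _ _).trans (le_of_eq ?_)
      rw [dist_smul₀, Real.norm_of_nonneg (by positivity)]; field_simp
  have hind : ∀ x, (A.indicator 1 x + ENNReal.ofReal (|un n x| ^ pbar) : ℝ≥0∞) ≠ ⊤ := by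
    intro x
    refine ENNReal.add_ne_top.2 ⟨?_, ENNReal.ofReal_ne_top⟩
    by_cases hx : x ∈ A <;> simp [hx]
  have hinner : ∀ x : Euc N, ∫⁻ y, (ENNReal.ofReal (auxK N s pminus R ‖x - y‖) +
      ENNReal.ofReal (auxK N s pbar R ‖x - y‖)) = K R := by
    intro x
    rw [lintegral_sub_left_eq_self (fun z : Euc N => ENNReal.ofReal (auxK N s pminus R ‖z‖) +
      ENNReal.ofReal (auxK N s pbar R ‖z‖)) x]
    exact lintegral_add_left ((auxK_meas N s pminus R).comp measurable_norm).ennreal_ofReal _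
  have hmeas : AEMeasurable (fun x => ENNReal.ofReal (|un n x| ^ pbar)) volume := by
    have h := (hmem n).1.aemeasurable
    rw [Measure.restrict_univ] at h
    have h' : AEMeasurable (fun x => |un n x|) volume := by simpa using h.norm
    exact (h'.pow_const pbar).ennreal_ofReal
  calc _ ≤ ∫⁻ x, ∫⁻ y, (A.indicator 1 x + ENNReal.ofReal (|un n x| ^ pbar)) *
        (ENNReal.ofReal (auxK N s pminus R ‖x - y‖) + ENNReal.ofReal (auxK N s pbar R ‖x - y‖)) :=
        lintegral_mono fun x => lintegral_mono fun y => hkb x y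
    _ = ∫⁻ x, (A.indicator 1 x + ENNReal.ofReal (|un n x| ^ pbar)) * K R := by
        refine lintegral_congr fun x => ?_
        rw [lintegral_const_mul' _ _ (hind x), hinner x]
    _ = (∫⁻ x, (A.indicator 1 x + ENNReal.ofReal (|un n x| ^ pbar))) * K R :=
        lintegral_mul_const' _ _ hKt
    _ ≤ W * K R := by
        refine mul_le_mul' ?_ le_rfl
        rw [lintegral_add_right' _ hmeas]
        refine add_le_add (lintegral_indicator_one_le A) ?_
        exact sob_bound N s pbar C p (fun x y => by linarith [hlow x y]) hxx hpb0.le _ (hmem n) (hC n)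
end
end
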